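/- The reduced integral homology group H̃_4(M_13; ℤ) is isomorphic to T ⊕ ℤ^24596, where T is a finite group containing a subgroup isomorphic to (ℤ/3ℤ)^10. In particular, H̃_4(M_13; ℤ) contains 3-torsion. -/

import Mathlib

set_option synthInstance.maxHeartbeats 1000000
set_option maxHeartbeats 1000000

noncomputable section

namespace MatchPaper

attribute [local instance 10] Classical.propDecidable

/-! ### Guarded constructions on additive groups -/

section AddGadgets

variable {A B : Type*} [AddCommGroup A] [AddCommGroup B]

/-- Lift a homomorphism to the quotient (it genuinely descends whenever it kills `S`). -/
def liftOrZero (S : AddSubgroup A) (f : A →+ B) : A ⧸ S →+ B :=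
  if h : S ≤ f.ker then QuotientAddGroup.lift S f h else 0

/-- Descend a homomorphism to quotients (genuine whenever `f S ≤ T`). -/
def descend (S : AddSubgroup A) (T : AddSubgroup B) (f : A →+ B) : A ⧸ S →+ B ⧸ T :=
  if h : S ≤ T.comap f then QuotientAddGroup.map S T f h else 0

/-- Restrict a homomorphism to subgroups (genuine whenever `f Z ≤ Z'`). -/
def restrictHom (f : A →+ B) (Z : AddSubgroup A) (Z' : AddSubgroup B) : Z →+ Z' :=
  if h : ∀ x : Z, f x ∈ Z' then (f.comp Z.subtype).codRestrict Z' (fun x => h x) else 0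

/-- The subquotient `Z / (Bd ∩ Z)`. -/
abbrev subQuot (Z Bd : AddSubgroup A) : Type _ := Z ⧸ Bd.addSubgroupOf Z

/-- The map induced by `f` on subquotients. -/
def subQuotMap (f : A →+ B) (Z Bd : AddSubgroup A) (Z' Bd' : AddSubgroup B) :
    subQuot Z Bd →+ subQuot Z' Bd' :=
  descend (Bd.addSubgroupOf Z) (Bd'.addSubgroupOf Z') (restrictHom f Z Z')

end AddGadgets

/-! ### Chain complexes of abelian groups, group actions, quotient and fixed-difference
subcomplexes, and homology -/

section Abstract

variable (X : ℤ → Type*) [∀ i, AddCommGroup (X i)]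

/-- Transport along an equality of indices. -/
def castAE {i j : ℤ} (h : i = j) : X i ≃+ X j := by subst h; exact AddEquiv.refl _

variable (d : ∀ i : ℤ, X (i + 1) →+ X i)

/-- The boundary map leaving degree `i`. -/
def dfrom (i : ℤ) : X i →+ X (i - 1) :=
  (d (i - 1)).comp (castAE X (show i = (i - 1) + 1 by ring)).toAddMonoidHom

/-- Cycles in degree `i`. -/
def cyc (i : ℤ) : AddSubgroup (X i) := (dfrom X d i).ker

/-- Boundaries in degree `i`. -/
def bdr (i : ℤ) : AddSubgroup (X i) := (d i).range

/-- Homology of the chain complex `(X, d)` in degree `i`. -/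
abbrev Hgrp (i : ℤ) : Type _ := subQuot (cyc X d i) (bdr X d i)

variable {G : Type*} [Group G] (act : G → ∀ i : ℤ, X i ≃+ X i)

/-- The subgroup `C_i^G` generated by the elements `c - g c`. -/
def gsub (i : ℤ) : AddSubgroup (X i) :=
  AddSubgroup.closure {x | ∃ (c : X i) (g : G), x = c - act g i c}

/-- The degree-`i` part of the quotient complex `C/G`. -/
abbrev QX (i : ℤ) : Type _ := X i ⧸ gsub X act i

/-- The boundary map of the quotient complex `C/G`. -/
def qd (i : ℤ) : QX X act (i + 1) →+ QX X act i :=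
  descend (gsub X act (i + 1)) (gsub X act i) (d i)

/-- Homology of the quotient complex `C/G`. -/
abbrev HQgrp (i : ℤ) : Type _ := Hgrp (QX X act) (qd X d act) i

/-- The boundary map of the subcomplex `C^G`. -/
def sd (i : ℤ) : gsub X act (i + 1) →+ gsub X act i :=
  restrictHom (d i) (gsub X act (i + 1)) (gsub X act i)

/-- Homology of the subcomplex `C^G`. -/
abbrev HSgrp (i : ℤ) : Type _ := Hgrp (fun j => gsub X act j) (sd X d act) i

/-- The projection chain map `C → C/G`. -/
def projX (i : ℤ) : X i →+ QX X act i := QuotientAddGroup.mk' _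

/-- The map `π*` induced on homology by the projection `C → C/G`. -/
def piStar (i : ℤ) : Hgrp X d i →+ HQgrp X d act i :=
  subQuotMap (projX X act i) (cyc X d i) (bdr X d i)
    (cyc (QX X act) (qd X d act) i) (bdr (QX X act) (qd X d act) i)

/-- The chain map `φ : C/G → C`, `[c] ↦ ∑ g • c`. -/
def phiX [Fintype G] (i : ℤ) : QX X act i →+ X i :=
  liftOrZero (gsub X act i) (∑ g : G, (act g i).toAddMonoidHom)

/-- The map `φ*` induced on homology by `φ`. -/
def phiStar [Fintype G] (i : ℤ) : HQgrp X d act i →+ Hgrp X d i :=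
  subQuotMap (phiX X act i) (cyc (QX X act) (qd X d act) i) (bdr (QX X act) (qd X d act) i)
    (cyc X d i) (bdr X d i)

end Abstract

/-! ### Guarded constructions on modules -/

section LinGadgets

variable (R : Type*) [CommRing R] {M N : Type*} [AddCommGroup M] [Module R M]
  [AddCommGroup N] [Module R N]

def liftOrZeroL (S : Submodule R M) (f : M →ₗ[R] N) : (M ⧸ S) →ₗ[R] N :=
  if h : S ≤ LinearMap.ker f then S.liftQ f h else 0

def descendL (S : Submodule R M) (T : Submodule R N) (f : M →ₗ[R] N) :
    (M ⧸ S) →ₗ[R] (N ⧸ T) :=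
  if h : S ≤ T.comap f then S.mapQ T f h else 0

def restrictL (f : M →ₗ[R] N) (Z : Submodule R M) (Z' : Submodule R N) : Z →ₗ[R] Z' :=
  if h : ∀ x ∈ Z, f x ∈ Z' then f.restrict h else 0

/-- The subquotient `Z / (Bd ∩ Z)`. -/
abbrev subQuotL (Z Bd : Submodule R M) : Type _ := Z ⧸ Bd.comap Z.subtype

def subQuotMapL (f : M →ₗ[R] N) (Z Bd : Submodule R M) (Z' Bd' : Submodule R N) :
    subQuotL R Z Bd →ₗ[R] subQuotL R Z' Bd' :=
  descendL R (Bd.comap Z.subtype) (Bd'.comap Z'.subtype) (restrictL R f Z Z')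

end LinGadgets

/-! ### Reduced simplicial chains and homology of a family of finite sets

A family `K : Finset V → Prop` of finite subsets of a vertex type `V` (in our applications a
simplicial complex, in particular closed under taking subsets and containing `∅`) has reduced
simplicial chain groups over a ring `R`: the degree-`d` chain group is free on the faces of
cardinality `d + 1`, i.e. we index chain groups by the cardinality `c = d + 1` of the faces,
with the empty face (cardinality `0`, degree `-1`) giving the augmentation.  Orientations are
induced by an injection `rank : V → ℕ` of the vertices into `ℕ`. -/

section Simplicial

variable (R : Type*) [CommRing R]

/-- Chains on the faces of cardinality `c` of the family `K`. -/
abbrev SChain {V : Type*} (K : Finset V → Prop) (c : ℕ) : Type _ :=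
  {σ : Finset V // K σ ∧ σ.card = c} →₀ R

/-- The basis chain of a face, or zero for a non-face. -/
def basisOrZero {V : Type*} (K : Finset V → Prop) (c : ℕ) (τ : Finset V) : SChain R K c :=
  if h : K τ ∧ τ.card = c then Finsupp.single ⟨τ, h⟩ (1 : R) else 0

/-- The simplicial boundary map, with signs determined by the ordering of the vertices via
`rank`. -/
def bdry {V : Type*} [DecidableEq V] (rank : V → ℕ) (K : Finset V → Prop) (c : ℕ) :
    SChain R K (c + 1) →ₗ[R] SChain R K c :=
  Finsupp.lsum R fun σ => LinearMap.toSpanSingleton R _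
    (∑ v ∈ σ.1, ((-1 : ℤ) ^ ((σ.1.filter fun u => rank u < rank v).card) •
      basisOrZero R K c (σ.1.erase v)))

/-- The orientation sign of a map `f` on a face `σ`: the parity of the number of inversions. -/
def mapSign {V W : Type*} (rank : V → ℕ) (rank' : W → ℕ) (f : V → W) (σ : Finset V) : ℤ :=
  (-1) ^ (((σ ×ˢ σ).filter fun p => rank p.1 < rank p.2 ∧ rank' (f p.2) < rank' (f p.1)).card)

/-- The chain map induced by a map `f` on vertices, taking orientations into account. -/
def chainMap {V W : Type*} [DecidableEq V] [DecidableEq W] (rank : V → ℕ) (rank' : W → ℕ)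
    (f : V → W) (K : Finset V → Prop) (K' : Finset W → Prop) (c : ℕ) :
    SChain R K c →ₗ[R] SChain R K' c :=
  Finsupp.lsum R fun σ => LinearMap.toSpanSingleton R _
    (mapSign rank rank' f σ.1 • basisOrZero R K' c (σ.1.image f))

/-- Cycles among the chains on faces of cardinality `c` (for `c = 0` everything is a cycle:
the boundary map leaving degree `-1` is zero). -/
def cycLow {V : Type*} [DecidableEq V] (rank : V → ℕ) (K : Finset V → Prop) :
    (c : ℕ) → Submodule R (SChain R K c)
  | 0 => ⊤
  | (m + 1) => LinearMap.ker (bdry R rank K m)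

/-- Reduced simplicial homology at the faces of cardinality `c`, i.e. in degree `c - 1`. -/
abbrev RHc {V : Type*} [DecidableEq V] (rank : V → ℕ) (K : Finset V → Prop) (c : ℕ) : Type _ :=
  subQuotL R (cycLow R rank K c) (LinearMap.range (bdry R rank K c))

/-- Reduced simplicial homology `H̃_dg(K; R)`. -/
abbrev RH {V : Type*} [DecidableEq V] (rank : V → ℕ) (K : Finset V → Prop) (dg : ℕ) : Type _ :=
  RHc R rank K (dg + 1)

end Simplicial

/-! ### The matching complex and the complexes of graphs of bounded degree -/

/-- The standard injection of pairs into `ℕ`, inducing the lexicographic order. -/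
def rankP (m : ℕ) : Fin m × Fin m → ℕ := fun p => p.1.val * m + p.2.val

/-- A face of the matching complex `M_m`: a set of edges `(i, j)`, `i < j`, of the complete
graph on `Fin m`, no two of which share an endpoint. -/
def IsMatching (m : ℕ) (σ : Finset (Fin m × Fin m)) : Prop :=
  (∀ p ∈ σ, p.1 < p.2) ∧
    ∀ p ∈ σ, ∀ q ∈ σ, p ≠ q → p.1 ≠ q.1 ∧ p.1 ≠ q.2 ∧ p.2 ≠ q.1 ∧ p.2 ≠ q.2

/-- `H̃_dg(M_m; R)`, the reduced homology of the matching complex on `m` vertices. -/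
abbrev MH (R : Type*) [CommRing R] (m dg : ℕ) : Type _ := RH R (rankP m) (IsMatching m) dg

/-- The degree of the vertex `i` in the graph `σ` (a loop `(i, i)` counts twice). -/
def degB {n : ℕ} (σ : Finset (Fin n × Fin n)) (i : Fin n) : ℕ :=
  ∑ p ∈ σ, ((if p.1 = i then 1 else 0) + (if p.2 = i then 1 else 0))

/-- A face of `BD_n^λ`: a graph on `Fin n` (loops allowed, encoded as pairs `(i, j)` with
`i ≤ j`) in which the vertex `i` has degree at most `λ i`. -/
def IsBDGraph {n : ℕ} (lam : Fin n → ℕ) (σ : Finset (Fin n × Fin n)) : Prop :=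
  (∀ p ∈ σ, p.1 ≤ p.2) ∧ ∀ i, degB σ i ≤ lam i

/-- `H̃_dg(BD_n^λ; R)`. -/
abbrev BDH (R : Type*) [CommRing R] {n : ℕ} (lam : Fin n → ℕ) (dg : ℕ) : Type _ :=
  RH R (rankP n) (IsBDGraph lam) dg

/-! ### The Young group action on the matching complex -/

/-- The action of a permutation of the vertices on the edges of the complete graph. -/
def emap {m : ℕ} (g : Equiv.Perm (Fin m)) : Fin m × Fin m → Fin m × Fin m :=
  fun p => (min (g p.1) (g p.2), max (g p.1) (g p.2))

/-- The quotient map on edges induced by a surjection `kap` on vertices (whose fibers are the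
blocks `U_i` of the partition). -/
def kmap {N n : ℕ} (kap : Fin N → Fin n) : Fin N × Fin N → Fin n × Fin n :=
  fun p => (min (kap p.1) (kap p.2), max (kap p.1) (kap p.2))

/-- Membership of a permutation in the Young group: it preserves each block of the partition
determined by `kap`. -/
def KeepsBlocks {N n : ℕ} (kap : Fin N → Fin n) (g : Equiv.Perm (Fin N)) : Prop :=
  ∀ x, kap (g x) = kap x

section YoungAction

variable (R : Type*) [CommRing R]

/-- The action of a permutation `g` of the `N` vertices on chains. -/
def actC (N : ℕ) (K : Finset (Fin N × Fin N) → Prop) (g : Equiv.Perm (Fin N)) (c : ℕ) :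
    SChain R K c →ₗ[R] SChain R K c :=
  chainMap R (rankP N) (rankP N) (emap g) K K c

/-- The submodule of chains generated by the elements `c - g c`, `g` in the Young group. -/
def ysub (N n : ℕ) (kap : Fin N → Fin n) (K : Finset (Fin N × Fin N) → Prop) (c : ℕ) :
    Submodule R (SChain R K c) :=
  Submodule.span R {x | ∃ (ch : SChain R K c) (g : Equiv.Perm (Fin N)),
    KeepsBlocks kap g ∧ x = ch - actC R N K g c ch}

/-- The chains of the quotient complex `C̃/S_λ`. -/
abbrev QC (N n : ℕ) (kap : Fin N → Fin n) (K : Finset (Fin N × Fin N) → Prop) (c : ℕ) :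
    Type _ :=
  SChain R K c ⧸ ysub R N n kap K c

/-- The boundary map of the quotient complex `C̃/S_λ`. -/
def qbdry (N n : ℕ) (kap : Fin N → Fin n) (K : Finset (Fin N × Fin N) → Prop) (c : ℕ) :
    QC R N n kap K (c + 1) →ₗ[R] QC R N n kap K c :=
  descendL R (ysub R N n kap K (c + 1)) (ysub R N n kap K c) (bdry R (rankP N) K c)

/-- Homology of the quotient complex `C̃(M_N)/S_λ` in degree `dg`. -/
abbrev QMH (N n : ℕ) (kap : Fin N → Fin n) (dg : ℕ) : Type _ :=
  subQuotL R (LinearMap.ker (qbdry R N n kap (IsMatching N) dg))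
    (LinearMap.range (qbdry R N n kap (IsMatching N) (dg + 1)))

/-- The chain map `φ : C̃/S_λ → C̃`, `[c] ↦ ∑_{g ∈ S_λ} g c`. -/
def phiC (N n : ℕ) (kap : Fin N → Fin n) (K : Finset (Fin N × Fin N) → Prop) (c : ℕ) :
    QC R N n kap K c →ₗ[R] SChain R K c :=
  liftOrZeroL R (ysub R N n kap K c)
    (∑ g ∈ Finset.univ.filter (fun g : Equiv.Perm (Fin N) => ∀ x, kap (g x) = kap x),
      actC R N K g c)

/-- The map `φ* : H_dg(C̃(M_N)/S_λ) → H̃_dg(M_N; R)` induced by `φ`. -/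
def phiStarM (N n : ℕ) (kap : Fin N → Fin n) (dg : ℕ) :
    QMH R N n kap dg →ₗ[R] MH R N dg :=
  subQuotMapL R (phiC R N n kap (IsMatching N) (dg + 1))
    (LinearMap.ker (qbdry R N n kap (IsMatching N) dg))
    (LinearMap.range (qbdry R N n kap (IsMatching N) (dg + 1)))
    (cycLow R (rankP N) (IsMatching N) (dg + 1))
    (LinearMap.range (bdry R (rankP N) (IsMatching N) (dg + 1)))

end YoungAction

/-! ### The subfamilies `Δ_λ` and `Γ_λ` of the matching complex -/

/-- `σ` contains two distinct edges `ab`, `cd` with `a, c` in the same block and `b, d` in the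
same block. -/
def InDelta {N n : ℕ} (kap : Fin N → Fin n) (σ : Finset (Fin N × Fin N)) : Prop :=
  ∃ p ∈ σ, ∃ q ∈ σ, p ≠ q ∧
    ((kap p.1 = kap q.1 ∧ kap p.2 = kap q.2) ∨ (kap p.1 = kap q.2 ∧ kap p.2 = kap q.1))

/-- A face of `Δ_λ`. -/
def IsDelta {N n : ℕ} (kap : Fin N → Fin n) (σ : Finset (Fin N × Fin N)) : Prop :=
  IsMatching N σ ∧ InDelta kap σ

/-- A face of `Γ_λ = M_N \ Δ_λ`. -/
def IsGamma {N n : ℕ} (kap : Fin N → Fin n) (σ : Finset (Fin N × Fin N)) : Prop :=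
  IsMatching N σ ∧ ¬ InDelta kap σ

section YoungMore

variable (R : Type*) [CommRing R]

/-- The map `κ̂ : C̃(Γ_λ)/S_λ → C̃(BD_n^λ)`, `[c] ↦ κ(c)`. -/
def khat (N n : ℕ) (kap : Fin N → Fin n) (lam : Fin n → ℕ) (c : ℕ) :
    QC R N n kap (IsGamma kap) c →ₗ[R] SChain R (IsBDGraph lam) c :=
  liftOrZeroL R (ysub R N n kap (IsGamma kap) c)
    (chainMap R (rankP N) (rankP n) (kmap kap) (IsGamma kap) (IsBDGraph lam) c)

/-- The boundary map of the subcomplex `C̃(M_N; R)^{S_λ}`. -/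
def sbdry (N n : ℕ) (kap : Fin N → Fin n) (c : ℕ) :
    ysub R N n kap (IsMatching N) (c + 1) →ₗ[R] ysub R N n kap (IsMatching N) c :=
  restrictL R (bdry R (rankP N) (IsMatching N) c)
    (ysub R N n kap (IsMatching N) (c + 1)) (ysub R N n kap (IsMatching N) c)

/-- Homology of the subcomplex `C̃(M_N; R)^{S_λ}` in degree `dg`: the cycles of the
subcomplex (elements of the subcomplex with vanishing boundary) modulo the boundaries of
elements of the subcomplex. -/
abbrev SubH (N n : ℕ) (kap : Fin N → Fin n) (dg : ℕ) : Type _ :=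
  subQuotL R
    (ysub R N n kap (IsMatching N) (dg + 1) ⊓ cycLow R (rankP N) (IsMatching N) (dg + 1))
    ((ysub R N n kap (IsMatching N) (dg + 1 + 1)).map (bdry R (rankP N) (IsMatching N) (dg + 1)))

/-! ### Inclusion maps between matching complexes -/

/-- The chain map induced by the inclusion `M_m ⊆ M_{m'}`. -/
def inclChain (m m' : ℕ) (h : m ≤ m') (c : ℕ) :
    SChain R (IsMatching m) c →ₗ[R] SChain R (IsMatching m') c :=
  chainMap R (rankP m) (rankP m') (fun p => (Fin.castLE h p.1, Fin.castLE h p.2))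
    (IsMatching m) (IsMatching m') c

/-- The map `H̃_dg(M_m; R) → H̃_dg(M_{m'}; R)` induced by the inclusion. -/
def inclStar (m m' : ℕ) (h : m ≤ m') (dg : ℕ) : MH R m dg →ₗ[R] MH R m' dg :=
  subQuotMapL R (inclChain R m m' h (dg + 1))
    (cycLow R (rankP m) (IsMatching m) (dg + 1))
    (LinearMap.range (bdry R (rankP m) (IsMatching m) (dg + 1)))
    (cycLow R (rankP m') (IsMatching m') (dg + 1))
    (LinearMap.range (bdry R (rankP m') (IsMatching m') (dg + 1)))

/-! ### The pair `(M_m, M_m \ e)`, where `e` is the last edge -/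

/-- The edge `e` between the last two of the `m` vertices. -/
def eEdge (m : ℕ) (h : 2 ≤ m) : Fin m × Fin m := (⟨m - 2, by omega⟩, ⟨m - 1, by omega⟩)

/-- A face of `M_m \ e`: a matching not containing the edge `e`. -/
def MnMinusE (m : ℕ) (h : 2 ≤ m) (σ : Finset (Fin m × Fin m)) : Prop :=
  IsMatching m σ ∧ eEdge m h ∉ σ

/-- Pass from a set of edges avoiding the last two vertices of `Fin m` to a set of edges on
`Fin (m - 2)`. -/
def shrink (m : ℕ) (σ : Finset (Fin m × Fin m)) : Finset (Fin (m - 2) × Fin (m - 2)) :=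
  (σ.filter fun p => p.1.val < m - 2 ∧ p.2.val < m - 2).attach.image
    fun p => (⟨p.1.1.val, (Finset.mem_filter.mp p.2).2.1⟩,
              ⟨p.1.2.val, (Finset.mem_filter.mp p.2).2.2⟩)

/-- The chain map realizing the composition
`C̃(M_m) → C̃(M_m, M_m \ e) ≅ C̃(M_{m - 2})[1]`: a face `σ` containing `e` is written as
`σ = ± e ∧ w` and sent to `± w`, viewed in the matching complex on the remaining `m - 2`
vertices; a face not containing `e` is sent to zero. -/
def theta (m : ℕ) (hm : 2 ≤ m) (c : ℕ) :
    SChain R (IsMatching m) (c + 1) →ₗ[R] SChain R (IsMatching (m - 2)) c :=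
  Finsupp.lsum R fun σ => LinearMap.toSpanSingleton R _
    (if eEdge m hm ∈ σ.1 then
      ((-1 : ℤ) ^ c) • basisOrZero R (IsMatching (m - 2)) c (shrink m (σ.1.erase (eEdge m hm)))
     else 0)

/-- The map `H̃_dg(M_m \ e; R) → H̃_dg(M_m; R)` induced by the inclusion. -/
def inclEStar (m : ℕ) (hm : 2 ≤ m) (dg : ℕ) :
    RH R (rankP m) (MnMinusE m hm) dg →ₗ[R] MH R m dg :=
  subQuotMapL R (chainMap R (rankP m) (rankP m) id (MnMinusE m hm) (IsMatching m) (dg + 1))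
    (cycLow R (rankP m) (MnMinusE m hm) (dg + 1))
    (LinearMap.range (bdry R (rankP m) (MnMinusE m hm) (dg + 1)))
    (cycLow R (rankP m) (IsMatching m) (dg + 1))
    (LinearMap.range (bdry R (rankP m) (IsMatching m) (dg + 1)))

/-- The composition `H̃_dg(M_m; R) → H_dg(M_m, M_m \ e; R) ≅ H̃_{dg - 1}(M_{m - 2}; R)` of the
map to relative homology with the canonical isomorphism. -/
def thetaStar (m : ℕ) (hm : 2 ≤ m) (dg : ℕ) :
    MH R m dg →ₗ[R] RHc R (rankP (m - 2)) (IsMatching (m - 2)) dg :=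
  subQuotMapL R (theta R m hm dg)
    (cycLow R (rankP m) (IsMatching m) (dg + 1))
    (LinearMap.range (bdry R (rankP m) (IsMatching m) (dg + 1)))
    (cycLow R (rankP (m - 2)) (IsMatching (m - 2)) dg)
    (LinearMap.range (bdry R (rankP (m - 2)) (IsMatching (m - 2)) dg))

end YoungMore

end MatchPaper

end

namespace MM
open MatchPaper

abbrev V := Fin 13
abbrev E := V × V

/-- alternating functions on lists -/
def Alt {α : Type*} (F : List α → ℤ) : Prop :=
  ∀ l1 x y l2, F (l1 ++ x :: y :: l2) = - F (l1 ++ y :: x :: l2)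

theorem Alt.cons {α : Type*} {F : List α → ℤ} (h : Alt F) (x : α) : Alt (fun l => F (x :: l)) := by
  intro l1 y z l2
  exact h (x :: l1) y z l2

theorem Alt.swap {α : Type*} {F : List α → ℤ} (h : Alt F) (x y : α) (l : List α) :
    F (x :: y :: l) = - F (y :: x :: l) := h [] x y l

theorem Alt.move {α : Type*} {F : List α → ℤ} (h : Alt F) (y : α) (l1 l2 : List α) :
    F (l1 ++ y :: l2) = (-1) ^ l1.length * F (y :: (l1 ++ l2)) := by
  induction l1 generalizing F with
  | nil => simp
  | cons x l1 ih =>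
    have := ih (h.cons x)
    simp only [List.cons_append, List.length_cons]
    rw [this, h.swap x y, pow_succ]
    ring

theorem Alt.mem_zero {α : Type*} {F : List α → ℤ} (h : Alt F) (y : α) (l : List α) (hy : y ∈ l) :
    F (y :: l) = 0 := by
  obtain ⟨l1, l2, rfl⟩ := List.append_of_mem hy
  have h1 := h.move y (y :: l1) l2
  have h2 := (h.cons y).move y l1 l2
  simp only [List.cons_append, List.length_cons, pow_succ] at h1 h2 ⊢
  have h3 := h.swap y y (l1 ++ l2)
  have h4 : F (y :: y :: (l1 ++ l2)) = 0 := by omega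
  rw [h2, h4, mul_zero]

theorem Alt.perm_mul {α : Type*} {F G : List α → ℤ} (hF : Alt F) (hG : Alt G) {l l' : List α}
    (h : l.Perm l') : F l * G l = F l' * G l' := by
  induction h generalizing F G with
  | nil => rfl
  | cons x _ ih => exact ih (hF.cons x) (hG.cons x)
  | swap x y l => rw [hF.swap, hG.swap]; ring
  | trans _ _ ih1 ih2 => exact (ih1 hF hG).trans (ih2 hF hG)

/-- the vertices of a list of edges -/
def vs {α : Type*} : List (α × α) → List α
  | [] => []
  | p :: l => p.1 :: p.2 :: vs l

theorem vs_append {α : Type*} (l1 l2 : List (α × α)) : vs (l1 ++ l2) = vs l1 ++ vs l2 := by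
  induction l1 with
  | nil => rfl
  | cons p l ih => simp [vs, ih]

theorem vs_length {α : Type*} (l : List (α × α)) : (vs l).length = 2 * l.length := by
  induction l with
  | nil => rfl
  | cons p l ih => simp [vs, ih]; ring

theorem vs_perm {α : Type*} {l l' : List (α × α)} (h : l.Perm l') : (vs l).Perm (vs l') := by
  induction h with
  | nil => rfl
  | cons x _ ih => simpa [vs] using ih
  | swap x y l =>
    simp only [vs]
    exact (List.perm_append_comm (l₁ := [y.1, y.2]) (l₂ := [x.1, x.2])).append_right (vs l)
  | trans _ _ ih1 ih2 => exact ih1.trans ih2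

theorem mem_vs {α : Type*} {l : List (α × α)} {v : α} :
    v ∈ vs l ↔ ∃ p ∈ l, v = p.1 ∨ v = p.2 := by
  induction l with
  | nil => simp [vs]
  | cons p l ih => simp only [vs, List.mem_cons, ih]; grind

/-- list of edges forming a matching -/
def Mt (l : List E) : Prop := (∀ p ∈ l, p.1 < p.2) ∧ (vs l).Nodup

theorem Mt.tail {p : E} {l : List E} (h : Mt (p :: l)) : Mt l :=
  ⟨fun q hq => h.1 q (List.mem_cons_of_mem _ hq), by
    have := h.2; simp only [vs, List.nodup_cons] at this; exact this.2.2⟩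

theorem Mt.perm {l l' : List E} (h : l.Perm l') (hm : Mt l) : Mt l' :=
  ⟨fun p hp => hm.1 p (h.mem_iff.2 hp), (vs_perm h).nodup_iff.1 hm.2⟩

theorem Mt.cons_iff {p : E} {l : List E} :
    Mt (p :: l) ↔ p.1 < p.2 ∧ p.1 ∉ vs l ∧ p.2 ∉ vs l ∧ Mt l := by
  constructor
  · intro h
    refine ⟨h.1 p (by simp), ?_, ?_, h.tail⟩
    · have := h.2; simp only [vs, List.nodup_cons, List.mem_cons] at this; grind
    · have := h.2; simp only [vs, List.nodup_cons, List.mem_cons] at this; grind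
  · rintro ⟨h1, h2, h3, h4⟩
    refine ⟨?_, ?_⟩
    · intro q hq
      rcases List.mem_cons.1 hq with rfl | hq
      · exact h1
      · exact h4.1 q hq
    · simp only [vs, List.nodup_cons, List.mem_cons]
      exact ⟨by rintro (h | h); exact h1.ne h; exact h2 h, h3, h4.2⟩

theorem Mt.nodup {l : List E} (h : Mt l) : l.Nodup := by
  induction l with
  | nil => simp
  | cons p l ih =>
    rw [Mt.cons_iff] at h
    rw [List.nodup_cons]
    refine ⟨fun hp => h.2.1 (mem_vs.2 ⟨p, hp, Or.inl rfl⟩), ih h.2.2.2⟩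

/-- alternating functions supported on matchings with `k` edges contained in `S` -/
structure Good (S : Finset V) (k : ℕ) (F : List E → ℤ) : Prop where
  alt : Alt F
  supp : ∀ l, F l ≠ 0 → Mt l ∧ l.length = k ∧ ∀ v ∈ vs l, v ∈ S

/-- boundary -/
def bd (F : List E → ℤ) (l : List E) : ℤ := ∑ x : E, F (x :: l)

/-- incidence -/
def ind (v : V) (x : E) : ℤ := if v = x.1 ∨ v = x.2 then 1 else 0

def mu (e x : E) : ℤ := ind e.1 x + ind e.2 x

def ed (a b : V) : E := (min a b, max a b)

theorem ed_comm (a b : V) : ed a b = ed b a := by simp [ed, min_comm, max_comm]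

theorem ed_eq {x : E} (h : x.1 < x.2) (a b : V) (hab : a ≠ b) (ha : a = x.1 ∨ a = x.2)
    (hb : b = x.1 ∨ b = x.2) : x = ed a b := by
  obtain ⟨x1, x2⟩ := x
  simp only [ed] at *
  ext
  · simp; grind
  · simp; grind

theorem vs_ed (a b : V) (l : List E) (v : V) : v ∈ vs (ed a b :: l) ↔ v = a ∨ v = b ∨ v ∈ vs l := by
  simp only [vs, ed, List.mem_cons]
  rcases le_total a b with h | h <;> simp [h] <;> tauto

theorem ind_ed (v a b : V) : ind v (ed a b) = if v = a ∨ v = b then 1 else 0 := by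
  simp only [ind, ed]
  rcases le_total a b with h | h <;> simp [h]
  congr 1; simp [or_comm]

/-- multilinear pairing -/
def Sm : List (E → ℤ) → (List E → ℤ) → ℤ
  | [], F => F []
  | h :: hs, F => ∑ x : E, h x * Sm hs (fun l => F (x :: l))

theorem Sm_zero (hs : List (E → ℤ)) : Sm hs (fun _ => 0) = 0 := by
  induction hs with
  | nil => rfl
  | cons h hs ih => simp [Sm, ih]

theorem Sm_add (hs : List (E → ℤ)) (F G : List E → ℤ) :
    Sm hs (fun l => F l + G l) = Sm hs F + Sm hs G := by
  induction hs generalizing F G with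
  | nil => rfl
  | cons h hs ih => simp [Sm, ih, mul_add, Finset.sum_add_distrib]

theorem Sm_smul (hs : List (E → ℤ)) (c : ℤ) (F : List E → ℤ) :
    Sm hs (fun l => c * F l) = c * Sm hs F := by
  induction hs generalizing F with
  | nil => rfl
  | cons h hs ih =>
    simp only [Sm, ih, Finset.mul_sum]
    exact Finset.sum_congr rfl fun x _ => by ring

theorem Sm_neg (hs : List (E → ℤ)) (F : List E → ℤ) :
    Sm hs (fun l => - F l) = - Sm hs F := by
  simpa using Sm_smul hs (-1) F

theorem Sm_sum {ι : Type*} (s : Finset ι) (hs : List (E → ℤ)) (F : ι → List E → ℤ) :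
    Sm hs (fun l => ∑ i ∈ s, F i l) = ∑ i ∈ s, Sm hs (F i) := by
  classical
  induction s using Finset.induction_on with
  | empty => simp [Sm_zero]
  | insert i s hi ih => simp only [Finset.sum_insert hi, Sm_add, ih]

theorem Sm_cons' (h : E → ℤ) (hs : List (E → ℤ)) (F : List E → ℤ) :
    Sm (h :: hs) F = Sm hs (fun l => ∑ x : E, h x * F (x :: l)) := by
  rw [Sm_sum]; simp only [Sm, Sm_smul]

theorem Sm_alt {F : List E → ℤ} (hF : Alt F) : Alt (fun hs => Sm hs F) := by
  intro l1 x y l2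
  induction l1 generalizing F with
  | nil =>
    simp only [List.nil_append, Sm]
    simp only [Finset.mul_sum]
    rw [Finset.sum_comm, ← Finset.sum_neg_distrib]
    refine Finset.sum_congr rfl fun b _ => ?_
    rw [← Finset.sum_neg_distrib]
    refine Finset.sum_congr rfl fun a _ => ?_
    have : (fun l => F (a :: b :: l)) = fun l => - F (b :: a :: l) := by
      funext l; exact hF.swap a b l
    rw [this, Sm_neg]; ring
  | cons h l1 ih =>
    simp only [List.cons_append, Sm]
    rw [← Finset.sum_neg_distrib]
    refine Finset.sum_congr rfl fun a _ => ?_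
    have := ih (hF.cons a)
    simp only at this
    rw [this]; ring

theorem Sm_head_add (h h' : E → ℤ) (hs : List (E → ℤ)) (F : List E → ℤ) :
    Sm ((fun x => h x + h' x) :: hs) F = Sm (h :: hs) F + Sm (h' :: hs) F := by
  simp [Sm, add_mul, Finset.sum_add_distrib]

theorem Sm_head_smul (c : ℤ) (h : E → ℤ) (hs : List (E → ℤ)) (F : List E → ℤ) :
    Sm ((fun x => c * h x) :: hs) F = c * Sm (h :: hs) F := by
  simp [Sm, mul_assoc, Finset.mul_sum]

theorem Sm_head_const (c : ℤ) (hs : List (E → ℤ)) (F : List E → ℤ) (hb : ∀ l, bd F l = 0) :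
    Sm ((fun _ => c) :: hs) F = 0 := by
  rw [Sm_cons']
  simp only [← Finset.mul_sum]
  have : ∀ l, ∑ x : E, F (x :: l) = 0 := hb
  simp [this, Sm_zero]

end MM


namespace MM
open MatchPaper

/-- sum over incident edges -/
def Av (G : E → List E → ℤ) (a : V) (l : List E) : ℤ := ∑ x : E, ind a x * G x l

def Nv (b : V) : List E → ℤ
  | [] => 0
  | y :: l => ind b y + Nv b l

theorem sum_ind_ind (b c : V) (hbc : b ≠ c) (H : E → ℤ) (hH : ∀ y, H y ≠ 0 → y.1 < y.2) :
    ∑ y : E, ind c y * (ind b y * H y) = H (ed b c) := by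
  rw [Finset.sum_eq_single (ed b c)]
  · simp [ind_ed]
  · intro y _ hy
    by_contra hne
    have h3 : H y ≠ 0 := by rintro h; simp [h] at hne
    have h1 : ind c y ≠ 0 := by rintro h; simp [h] at hne
    have h2 : ind b y ≠ 0 := by rintro h; simp [h] at hne
    have h1' : c = y.1 ∨ c = y.2 := by by_contra h; exact h1 (by simp [ind, h])
    have h2' : b = y.1 ∨ b = y.2 := by by_contra h; exact h2 (by simp [ind, h])
    exact hy (ed_eq (hH y h3) b c hbc h2' h1')
  · simp

theorem lemL (a b : V) (ab : E) (t : List E)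
    (ht : ∀ p ∈ t, p.1 ≠ a ∧ p.1 ≠ b ∧ p.2 ≠ a ∧ p.2 ≠ b) (G : E → List E → ℤ)
    (hO : ∀ x l, G x l ≠ 0 → ∀ p ∈ l, p.1 < p.2)
    (hR : ∀ w, w ≠ a → w ≠ b → ∀ l1 l2, Av G a (l1 ++ ed b w :: l2) + Av G b (l1 ++ ed a w :: l2)
      = ∑ x : E, ind w x * G ab (l1 ++ x :: l2)) :
    Sm (t.map mu) (fun l => Nv b l * Av G a l + Nv a l * Av G b l)
      = t.length * Sm (t.map mu) (G ab) := by
  induction t generalizing G with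
  | nil => simp [Sm, Nv]
  | cons p t ih =>
    have htp := ht p (by simp)
    have ht' : ∀ p ∈ t, p.1 ≠ a ∧ p.1 ≠ b ∧ p.2 ≠ a ∧ p.2 ≠ b :=
      fun q hq => ht q (List.mem_cons_of_mem _ hq)
    have key : ∀ y : E, Sm (t.map mu) (fun l => Nv b l * Av G a (y :: l) + Nv a l * Av G b (y :: l))
        = t.length * Sm (t.map mu) (fun l => G ab (y :: l)) := by
      intro y
      exact ih ht' (fun x l => G x (y :: l)) (fun x l h p hp => hO x _ h p (by simp [hp]))
        (fun w h1 h2 l1 l2 => hR w h1 h2 (y :: l1) l2)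
    have hAv : ∀ v y l, Av G v (y :: l) ≠ 0 → y.1 < y.2 := by
      intro v y l h
      obtain ⟨x, _, hx⟩ := Finset.exists_ne_zero_of_sum_ne_zero h
      exact hO x (y :: l) (by rintro h; simp [h] at hx) y (by simp)
    have first : Sm (t.map mu) (fun l => ∑ y : E, mu p y *
        (ind b y * Av G a (y :: l) + ind a y * Av G b (y :: l)))
        = Sm (t.map mu) (fun l => ∑ y : E, mu p y * G ab (y :: l)) := by
      congr 1
      funext l
      have e1 := sum_ind_ind b p.1 htp.2.1.symm (fun y => Av G a (y :: l)) (fun y => hAv a y l)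
      have e2 := sum_ind_ind b p.2 htp.2.2.2.symm (fun y => Av G a (y :: l)) (fun y => hAv a y l)
      have e3 := sum_ind_ind a p.1 htp.1.symm (fun y => Av G b (y :: l)) (fun y => hAv b y l)
      have e4 := sum_ind_ind a p.2 htp.2.2.1.symm (fun y => Av G b (y :: l)) (fun y => hAv b y l)
      have r1 := hR p.1 htp.1 htp.2.1 [] l
      have r2 := hR p.2 htp.2.2.1 htp.2.2.2 [] l
      simp only [List.nil_append] at r1 r2
      simp only [mu, add_mul, mul_add, Finset.sum_add_distrib]
      rw [e1, e2, e3, e4, ← r1, ← r2]; ring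
    simp only [List.map_cons, List.length_cons]
    rw [Sm_cons', Sm_cons']
    have split : (fun l => ∑ x : E, mu p x * (Nv b (x :: l) * Av G a (x :: l)
        + Nv a (x :: l) * Av G b (x :: l)))
        = fun l => (∑ y : E, mu p y * (ind b y * Av G a (y :: l) + ind a y * Av G b (y :: l)))
          + ∑ y : E, mu p y * (Nv b l * Av G a (y :: l) + Nv a l * Av G b (y :: l)) := by
      funext l
      rw [← Finset.sum_add_distrib]
      refine Finset.sum_congr rfl fun y _ => ?_
      simp only [Nv]; ring
    rw [split, Sm_add, first, Sm_sum, Sm_sum]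
    simp only [Sm_smul]
    simp only [key]
    push_cast
    rw [add_mul, one_mul, Finset.mul_sum, add_comm]
    congr 1
    exact Finset.sum_congr rfl fun x _ => by ring

section
variable {S : Finset V} {k : ℕ} {F : List E → ℤ}

theorem Good.memS (hF : Good S k F) {l : List E} (h : F l ≠ 0) {v : V} (hv : v ∈ vs l) : v ∈ S :=
  (hF.supp l h).2.2 v hv

/-- free vertices -/
def free (S : Finset V) (l : List E) : Finset V := S \ (vs l).toFinset

theorem free_card (l : List E) (hl : Mt l) (hs : ∀ v ∈ vs l, v ∈ S) :
    (free S l).card + 2 * l.length = S.card := by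
  rw [free, ← vs_length, ← List.toFinset_card_of_nodup hl.2]
  exact Finset.card_sdiff_add_card_eq_card (by intro v hv; exact hs v (by simpa using hv))

theorem Good.head (hF : Good S k F) {x : E} {l : List E} (h : F (x :: l) ≠ 0) :
    x.1 < x.2 ∧ x.1 ∈ free S l ∧ x.2 ∈ free S l ∧ Mt l ∧ l.length + 1 = k ∧ ∀ v ∈ vs l, v ∈ S := by
  obtain ⟨h1, h2, h3⟩ := hF.supp _ h
  rw [Mt.cons_iff] at h1
  refine ⟨h1.1, ?_, ?_, h1.2.2.2, h2, fun v hv => h3 v (by simp [vs, hv])⟩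
  · simp only [free, Finset.mem_sdiff, List.mem_toFinset]
    exact ⟨h3 _ (by simp [vs]), h1.2.1⟩
  · simp only [free, Finset.mem_sdiff, List.mem_toFinset]
    exact ⟨h3 _ (by simp [vs]), h1.2.2.1⟩

theorem Good.zero_of_mem (hF : Good S k F) {x : E} {l : List E} {v : V} (hv : v ∈ vs l)
    (hx : v = x.1 ∨ v = x.2) : F (x :: l) = 0 := by
  by_contra h
  obtain ⟨_, h1, h2, _⟩ := hF.head h
  simp only [free, Finset.mem_sdiff, List.mem_toFinset] at h1 h2
  rcases hx with rfl | rfl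
  · exact h1.2 hv
  · exact h2.2 hv

theorem four_le {T : Finset V} (hT : T.card = 3) {a b c d : V} (ha : a ∈ T) (hb : b ∈ T) (hc : c ∈ T)
    (hd : d ∈ T) (h1 : a ≠ b) (h2 : a ≠ c) (h3 : a ≠ d) (h4 : b ≠ c) (h5 : b ≠ d) (h6 : c ≠ d) :
    False := by
  have : ({a, b, c, d} : Finset V).card ≤ T.card := Finset.card_le_card (by
    intro x hx; simp at hx; rcases hx with rfl | rfl | rfl | rfl <;> assumption)
  rw [hT, Finset.card_insert_of_notMem (by simp; grind), Finset.card_insert_of_notMem (by simp; grind),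
    Finset.card_insert_of_notMem (by simp; grind), Finset.card_singleton] at this
  omega

/-- boundary as a sum of three terms -/
theorem bd_three (hS : S.card = 2 * k + 1) (hF : Good S k F) (l : List E)
    {a b w : V} (hab : a ≠ b) (haw : a ≠ w) (hbw : b ≠ w)
    (ha : a ∈ S) (hbS : b ∈ S) (hw : w ∈ S)
    (ha' : a ∉ vs l) (hb' : b ∉ vs l) (hw' : w ∉ vs l) :
    bd F l = F (ed a b :: l) + F (ed b w :: l) + F (ed a w :: l) := by
  have hne : ∀ x : E, F (x :: l) ≠ 0 → x = ed a b ∨ x = ed b w ∨ x = ed a w := by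
    intro x hx
    obtain ⟨h1, h2, h3, h4, h5, h6⟩ := hF.head hx
    have hc : (free S l).card = 3 := by have := free_card l h4 h6; omega
    have ma : a ∈ free S l := by simp [free, ha, ha']
    have mb : b ∈ free S l := by simp [free, hbS, hb']
    have mw : w ∈ free S l := by simp [free, hw, hw']
    have t1 : x.1 = a ∨ x.1 = b ∨ x.1 = w := by
      by_contra hcon; push Not at hcon
      exact four_le hc ma mb mw h2 hab haw hcon.1.symm hbw hcon.2.1.symm hcon.2.2.symm
    have t2 : x.2 = a ∨ x.2 = b ∨ x.2 = w := by
      by_contra hcon; push Not at hcon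
      exact four_le hc ma mb mw h3 hab haw hcon.1.symm hbw hcon.2.1.symm hcon.2.2.symm
    by_cases c1 : w = x.1 ∨ w = x.2
    · by_cases c2 : a = x.1 ∨ a = x.2
      · right; right; exact ed_eq h1 a w haw c2 c1
      · right; left; refine ed_eq h1 b w hbw ?_ c1; grind
    · left; refine ed_eq h1 a b hab ?_ ?_ <;> grind
  have d1 : ed a b ≠ ed b w := by
    intro h; have := (vs_ed a b [] a).2 (Or.inl rfl); rw [h, vs_ed] at this; simp [vs] at this; tauto
  have d2 : ed a b ≠ ed a w := by
    intro h; have := (vs_ed a b [] b).2 (Or.inr (Or.inl rfl)); rw [h, vs_ed] at this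
    simp [vs] at this; rcases this with h | h
    · exact hab h.symm
    · exact hbw h
  have d3 : ed b w ≠ ed a w := by
    intro h; have := (vs_ed b w [] b).2 (Or.inl rfl); rw [h, vs_ed] at this
    simp [vs] at this; rcases this with h | h
    · exact hab h.symm
    · exact hbw h
  have hsum : bd F l = ∑ x ∈ ({ed a b, ed b w, ed a w} : Finset E), F (x :: l) := by
    rw [bd]; symm
    apply Finset.sum_subset (Finset.subset_univ _)
    intro x _ hx
    by_contra h
    exact hx (by simpa using hne x h)
  rw [Finset.sum_insert (by simp [d1, d2]), Finset.sum_insert (by simp [d3]), Finset.sum_singleton]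
    at hsum
  linarith

/-- three term relation -/
theorem three_term (hS : S.card = 2 * k + 1) (hF : Good S k F) (l : List E) (hb : bd F l = 0)
    {a b w : V} (hab : a ≠ b) (haw : a ≠ w) (hbw : b ≠ w)
    (ha : a ∈ S) (hbS : b ∈ S) (hw : w ∈ S)
    (ha' : a ∉ vs l) (hb' : b ∉ vs l) (hw' : w ∉ vs l) :
    F (ed a b :: l) + F (ed b w :: l) + F (ed a w :: l) = 0 := by
  rw [← bd_three hS hF l hab haw hbw ha hbS hw ha' hb' hw', hb]

theorem Good.Rrel (hS : S.card = 2 * k + 1) (hF : Good S k F) (hb : ∀ l, bd F l = 0)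
    {a b w : V} (hab : a ≠ b) (haw : a ≠ w) (hbw : b ≠ w) (r : List E) :
    ∑ x : E, (ind a x * F (ed b w :: x :: r) + ind b x * F (ed a w :: x :: r)
      + ind w x * F (ed a b :: x :: r)) = 0 := by
  have gen : ∀ (x : E) (u v : V), F (ed u v :: x :: r) ≠ 0 → (u ∈ S ∧ v ∈ S ∧ u ∉ vs r ∧ v ∉ vs r ∧
      (∀ z, ind z x ≠ 0 → z ∈ S ∧ z ∉ vs r) ∧ ind u x = 0 ∧ ind v x = 0) := by
    intro x u v h
    obtain ⟨h1, h2, h3⟩ := hF.supp _ h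
    have hu := h3 u (by rw [vs_ed]; simp)
    have hv := h3 v (by rw [vs_ed]; simp)
    have p1 : ∀ z, (z = u ∨ z = v) → z ∉ vs (x :: r) := by
      intro z hz hz'
      refine absurd (hF.zero_of_mem (x := ed u v) hz' ?_) h
      have : z ∈ vs [ed u v] := by rw [vs_ed]; tauto
      simpa [vs] using this
    have pu := p1 u (Or.inl rfl)
    have pv := p1 v (Or.inr rfl)
    simp only [vs, List.mem_cons, not_or] at pu pv
    refine ⟨hu, hv, pu.2.2, pv.2.2, ?_, by simp [ind, pu], by simp [ind, pv]⟩
    intro z hz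
    have hz' : z = x.1 ∨ z = x.2 := by by_contra h; exact hz (by simp [ind, h])
    have hm := (Mt.cons_iff.1 h1).2.2.2
    rw [Mt.cons_iff] at hm
    refine ⟨h3 z ?_, ?_⟩
    · rw [vs_ed]; right; right; simp only [vs, List.mem_cons]; tauto
    · rcases hz' with rfl | rfl
      · exact hm.2.1
      · exact hm.2.2.1
  by_cases hc : (a ∈ S ∧ b ∈ S ∧ w ∈ S) ∧ a ∉ vs r ∧ b ∉ vs r ∧ w ∉ vs r
  · obtain ⟨⟨aS, bS, wS⟩, ar, br, wr⟩ := hc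
    have z : ∀ u v : V, ∑ x : E, F (ed u v :: x :: r) = 0 := by
      intro u v
      have := hb (ed u v :: r)
      rw [bd] at this
      rw [← neg_eq_zero, ← Finset.sum_neg_distrib, ← this]
      exact Finset.sum_congr rfl fun x _ => (hF.alt.swap _ _ _).symm
    have e : ∑ x : E, (ind a x * F (ed b w :: x :: r) + ind b x * F (ed a w :: x :: r)
        + ind w x * F (ed a b :: x :: r)) = ∑ x : E, ((ind a x - 1) * F (ed b w :: x :: r)
        + (ind b x - 1) * F (ed a w :: x :: r) + (ind w x - 1) * F (ed a b :: x :: r)) := by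
      simp only [sub_mul, Finset.sum_add_distrib, Finset.sum_sub_distrib, one_mul, z, sub_zero]
    rw [e]
    apply Finset.sum_eq_zero
    intro x _
    have i01 : ∀ v, ind v x = 0 ∨ ind v x = 1 := by intro v; unfold ind; split_ifs <;> simp
    by_cases hd : ind a x = 0 ∧ ind b x = 0 ∧ ind w x = 0
    · have nm : ∀ v, v ∉ vs r → ind v x = 0 → v ∉ vs (x :: r) := by
        intro v hv hx
        simp only [ind, ite_eq_right_iff, one_ne_zero, imp_false, not_or] at hx
        simp [vs, hx, hv]
      have := three_term hS hF (x :: r) (hb _) hab haw hbw aS bS wS (nm a ar hd.1) (nm b br hd.2.1)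
        (nm w wr hd.2.2)
      rw [hd.1, hd.2.1, hd.2.2]; linarith
    · have q1 : (ind a x - 1) * F (ed b w :: x :: r) = 0 := by
        by_contra h
        have := gen x b w (by rintro h'; simp [h'] at h)
        rcases i01 a with h' | h'
        · exact hd ⟨h', this.2.2.2.2.2⟩
        · simp [h'] at h
      have q2 : (ind b x - 1) * F (ed a w :: x :: r) = 0 := by
        by_contra h
        have := gen x a w (by rintro h'; simp [h'] at h)
        rcases i01 b with h' | h'
        · exact hd ⟨this.2.2.2.2.2.1, h', this.2.2.2.2.2.2⟩
        · simp [h'] at h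
      have q3 : (ind w x - 1) * F (ed a b :: x :: r) = 0 := by
        by_contra h
        have := gen x a b (by rintro h'; simp [h'] at h)
        rcases i01 w with h' | h'
        · exact hd ⟨this.2.2.2.2.2.1, this.2.2.2.2.2.2, h'⟩
        · simp [h'] at h
      rw [q1, q2, q3]; rfl
  · apply Finset.sum_eq_zero
    intro x _
    have q : ∀ u v z : V, ((u ∈ S ∧ v ∈ S ∧ z ∈ S ∧ u ∉ vs r ∧ v ∉ vs r ∧ z ∉ vs r) → False) →
        ind z x * F (ed u v :: x :: r) = 0 := by
      intro u v z hh
      by_contra h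
      have g := gen x u v (by rintro h'; simp [h'] at h)
      have g2 := g.2.2.2.2.1 z (by rintro h'; simp [h'] at h)
      exact hh ⟨g.1, g.2.1, g2.1, g.2.2.1, g.2.2.2.1, g2.2⟩
    rw [q b w a (by tauto), q a w b (by tauto), q a b w (by tauto)]; rfl

theorem main_b (k : ℕ) (S : Finset V) (F : List E → ℤ) (hS : S.card = 2 * k + 1) (hF : Good S k F)
    (hb : ∀ l, bd F l = 0) (e : List E) (he : Mt e) (hek : e.length = k) (heS : ∀ v ∈ vs e, v ∈ S) :
    Sm (e.map mu) F = k.factorial * F e := by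
  induction k generalizing S F e with
  | zero =>
    have : e = [] := List.length_eq_zero_iff.1 hek
    subst this; simp [Sm]
  | succ k ih =>
    match e, he, hek, heS with
    | ab :: t, he, hek, heS =>
    obtain ⟨a, b⟩ := ab
    have hlt := Mt.cons_iff.1 he
    simp only at hlt
    have hab : a ≠ b := hlt.1.ne
    have hmk : ed a b = (a, b) := by simp [ed, hlt.1.le]
    have haS : a ∈ S := heS a (by simp [vs])
    have hbS : b ∈ S := heS b (by simp [vs])
    have htk : t.length = k := by simpa using hek
    -- the inner function
    have hinner : Sm (t.map mu) (fun l => F ((a, b) :: l)) = k.factorial * F ((a, b) :: t) := by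
      refine ih (S \ {a, b}) _ ?_ ⟨hF.alt.cons _, ?_⟩ ?_ t hlt.2.2.2 htk ?_
      · rw [Finset.card_sdiff_of_subset (by intro x; simp; rintro (rfl | rfl) <;> assumption),
          Finset.card_pair hab]; omega
      · intro l hl
        obtain ⟨_, h2, h3, h4, h5, h6⟩ := hF.head hl
        refine ⟨h4, by omega, fun v hv => ?_⟩
        simp only [free, Finset.mem_sdiff, List.mem_toFinset] at h2 h3
        simp only [Finset.mem_sdiff, Finset.mem_insert, Finset.mem_singleton, not_or]
        refine ⟨h6 v hv, ?_, ?_⟩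
        · rintro rfl; exact h2.2 hv
        · rintro rfl; exact h3.2 hv
      · intro l
        rw [bd, ← neg_eq_zero, ← Finset.sum_neg_distrib, ← hb ((a, b) :: l), bd]
        exact Finset.sum_congr rfl fun x _ => (hF.alt.swap _ _ _).symm
      · intro v hv
        simp only [Finset.mem_sdiff, Finset.mem_insert, Finset.mem_singleton, not_or]
        refine ⟨heS v (by simp [vs, hv]), ?_, ?_⟩
        · rintro rfl; exact hlt.2.1 hv
        · rintro rfl; exact hlt.2.2.1 hv
    let G : E → List E → ℤ := fun x l => F (x :: l)
    have hL : Sm (t.map mu) (fun l => Nv b l * Av G a l + Nv a l * Av G b l)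
        = t.length * Sm (t.map mu) (G (a, b)) := by
      apply lemL
      · intro p hp
        refine ⟨?_, ?_, ?_, ?_⟩
        · rintro rfl; exact hlt.2.1 (mem_vs.2 ⟨p, hp, Or.inl rfl⟩)
        · rintro rfl; exact hlt.2.2.1 (mem_vs.2 ⟨p, hp, Or.inl rfl⟩)
        · rintro rfl; exact hlt.2.1 (mem_vs.2 ⟨p, hp, Or.inr rfl⟩)
        · rintro rfl; exact hlt.2.2.1 (mem_vs.2 ⟨p, hp, Or.inr rfl⟩)
      · intro x l h p hp
        exact (hF.supp _ h).1.1 p (by simp [hp])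
      · intro w hwa hwb l1 l2
        have hR := hF.Rrel hS hb hab hwa.symm hwb.symm (l1 ++ l2)
        have mv : ∀ x y : E, F (x :: (l1 ++ y :: l2)) = (-1) ^ l1.length * F (x :: y :: (l1 ++ l2)) :=
          fun x y => (hF.alt.cons x).move y l1 l2
        simp only [Av, G, mv]
        rw [hmk] at hR
        have sw : ∀ x y : E, F (x :: y :: (l1 ++ l2)) = - F (y :: x :: (l1 ++ l2)) :=
          fun x y => hF.alt.swap x y _
        rw [← Finset.sum_add_distrib, ← sub_eq_zero, ← Finset.sum_sub_distrib]
        have : (-1) ^ (l1.length + 1) * ∑ x : E, (ind a x * F (ed b w :: x :: (l1 ++ l2))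
          + ind b x * F (ed a w :: x :: (l1 ++ l2)) + ind w x * F ((a, b) :: x :: (l1 ++ l2))) = 0 := by
          rw [hR, mul_zero]
        rw [← this, Finset.mul_sum]
        refine Finset.sum_congr rfl fun x _ => ?_
        rw [sw x (ed b w), sw x (ed a w), pow_succ]; ring
    have hpt : (fun l => ∑ x : E, mu (a, b) x * F (x :: l))
        = fun l => F ((a, b) :: l) + (Nv b l * Av G a l + Nv a l * Av G b l) := by
      funext l
      have hAB : ∑ x : E, mu (a, b) x * F (x :: l) = Av G a l + Av G b l := by
        simp only [mu, Av, G, add_mul, Finset.sum_add_distrib]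
      rw [hAB]
      by_cases hl : Mt l ∧ l.length = k ∧ ∀ v ∈ vs l, v ∈ S
      · obtain ⟨hl1, hl2, hl3⟩ := hl
        have Av0 : ∀ v, v ∈ vs l → Av G v l = 0 := by
          intro v hv
          apply Finset.sum_eq_zero
          intro x _
          by_cases hx : v = x.1 ∨ v = x.2
          · simp only [G]; rw [hF.zero_of_mem hv hx, mul_zero]
          · simp [ind, hx]
        have Nv0 : ∀ v (l : List E), v ∉ vs l → Nv v l = 0 := by
          intro v l
          induction l with
          | nil => simp [Nv]
          | cons p l ih =>
            intro h
            simp only [vs, List.mem_cons, not_or] at h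
            simp [Nv, ind, h, ih h.2.2]
        have Nv1 : ∀ v (l : List E), Mt l → v ∈ vs l → Nv v l = 1 := by
          intro v l
          induction l with
          | nil => simp [vs]
          | cons p l ih =>
            intro h hv
            rw [Mt.cons_iff] at h
            simp only [vs, List.mem_cons] at hv
            by_cases hx : v = p.1 ∨ v = p.2
            · have : v ∉ vs l := by rcases hx with rfl | rfl; exact h.2.1; exact h.2.2.1
              simp [Nv, ind, hx, Nv0 v l this]
            · simp [Nv, ind, hx, ih h.2.2.2 (by tauto)]
        by_cases ca : a ∈ vs l
        · rw [Av0 a ca, Nv1 a l hl1 ca, hF.zero_of_mem ca (Or.inl rfl)]; ring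
        · by_cases cb : b ∈ vs l
          · rw [Av0 b cb, Nv1 b l hl1 cb, hF.zero_of_mem cb (Or.inr rfl)]; ring
          · rw [Nv0 a l ca, Nv0 b l cb]
            have hb' := hb l
            rw [bd] at hb'
            have : Av G a l + Av G b l = ∑ x : E, (ind a x + ind b x - 1) * F (x :: l) := by
              simp only [sub_mul, add_mul, Finset.sum_sub_distrib, Finset.sum_add_distrib, one_mul, hb',
                Av, G]; ring
            rw [this, Finset.sum_eq_single (a, b)]
            · simp [ind]
            · intro x _ hx
              by_contra h
              have hx0 : F (x :: l) ≠ 0 := by rintro h'; simp [h'] at h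
              obtain ⟨h1, h2, h3, h4, h5, h6⟩ := hF.head hx0
              have hc : (free S l).card = 3 := by have := free_card l h4 h6; omega
              have ma : a ∈ free S l := by simp [free, haS, ca]
              have mb : b ∈ free S l := by simp [free, hbS, cb]
              by_cases c1 : a = x.1 ∨ a = x.2
              · by_cases c2 : b = x.1 ∨ b = x.2
                · exact hx (by rw [ed_eq h1 a b hab c1 c2, hmk])
                · simp [ind, c1, c2] at h
              · by_cases c2 : b = x.1 ∨ b = x.2
                · simp [ind, c1, c2] at h
                · push Not at c1 c2
                  exact four_le hc ma mb h2 h3 hab c1.1 c1.2 c2.1 c2.2 h1.ne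
            · simp
      · have z : ∀ x : E, F (x :: l) = 0 := by
          intro x; by_contra h
          obtain ⟨_, _, _, h4, h5, h6⟩ := hF.head h
          exact hl ⟨h4, by omega, h6⟩
        simp [Av, G, z]
    rw [List.map_cons, Sm_cons', hpt, Sm_add, hL, htk]
    simp only [G]
    rw [hinner, Nat.factorial_succ]
    push_cast; ring

end
end MM


namespace MM
open MatchPaper

abbrev rk : E → ℕ := rankP 13
abbrev K : Finset E → Prop := IsMatching 13
abbrev C (c : ℕ) : Type := SChain ℤ K c
noncomputable abbrev D (c : ℕ) : C (c + 1) →ₗ[ℤ] C c := bdry ℤ rk K c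

theorem rk_inj : Function.Injective rk := by
  rintro ⟨a, b⟩ ⟨c, d⟩ h
  simp only [rk, rankP] at h
  have := b.isLt; have := d.isLt
  ext <;> simp <;> omega

/-- sign of a list of edges -/
noncomputable def sg : List E → ℤ
  | [] => 1
  | x :: l => (l.map (fun y => Int.sign ((rk y : ℤ) - rk x))).prod * sg l

theorem sg_alt : Alt sg := by
  intro l1 x y l2
  induction l1 with
  | nil =>
    simp only [List.nil_append, sg, List.map_cons, List.prod_cons]
    have : Int.sign ((rk y : ℤ) - rk x) = - Int.sign ((rk x : ℤ) - rk y) := by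
      rw [← Int.sign_neg]; congr 1; ring
    rw [this]; ring
  | cons z l1 ih =>
    simp only [List.cons_append, sg, ih]
    have : ((l1 ++ x :: y :: l2).map (fun y => Int.sign ((rk y : ℤ) - rk z))).prod
        = ((l1 ++ y :: x :: l2).map (fun y => Int.sign ((rk y : ℤ) - rk z))).prod := by
      apply List.Perm.prod_eq
      apply List.Perm.map
      exact List.Perm.append_left _ (List.Perm.swap _ _ _)
    rw [this]; ring

theorem sg_sq {l : List E} (h : l.Nodup) : sg l * sg l = 1 := by
  induction l with
  | nil => rfl
  | cons x l ih =>
    rw [List.nodup_cons] at h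
    have h2 : ∀ l' : List E, x ∉ l' → (l'.map (fun y => Int.sign ((rk y : ℤ) - rk x))).prod
        * (l'.map (fun y => Int.sign ((rk y : ℤ) - rk x))).prod = 1 := by
      intro l' hl
      induction l' with
      | nil => rfl
      | cons y l' ih' =>
        simp only [List.mem_cons, not_or] at hl
        simp only [List.map_cons, List.prod_cons]
        have h3 : ((rk y : ℤ) - rk x) ≠ 0 := by
          intro h; apply hl.1; apply rk_inj; omega
        have h4 : Int.sign ((rk y : ℤ) - rk x) * Int.sign ((rk y : ℤ) - rk x) = 1 := by
          rcases lt_or_gt_of_ne h3 with h | h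
          · rw [Int.sign_eq_neg_one_of_neg h]; rfl
          · rw [Int.sign_eq_one_of_pos h]; rfl
        calc _ = (Int.sign ((rk y : ℤ) - rk x) * Int.sign ((rk y : ℤ) - rk x)) *
          ((l'.map (fun y => Int.sign ((rk y : ℤ) - rk x))).prod
            * (l'.map (fun y => Int.sign ((rk y : ℤ) - rk x))).prod) := by ring
          _ = 1 := by rw [h4, ih' hl.2]; rfl
    simp only [sg]
    calc _ = ((l.map (fun y => Int.sign ((rk y : ℤ) - rk x))).prod
      * (l.map (fun y => Int.sign ((rk y : ℤ) - rk x))).prod) * (sg l * sg l) := by ring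
      _ = 1 := by rw [h2 l h.1, ih h.2]; rfl

theorem sg_zero {l : List E} (h : ¬ l.Nodup) : sg l = 0 := by
  induction l with
  | nil => simp at h
  | cons x l ih =>
    rw [List.nodup_cons, not_and_or, not_not] at h
    rcases h with h | h
    · simp only [sg]
      have : (l.map (fun y => Int.sign ((rk y : ℤ) - rk x))).prod = 0 := by
        apply List.prod_eq_zero
        simp only [List.mem_map]
        exact ⟨x, h, by simp⟩
      rw [this, zero_mul]
    · simp [sg, ih h]

theorem sg_cons {x : E} {l : List E} (hl : l.Nodup) (hx : x ∉ l) :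
    sg (x :: l) = (-1) ^ ((l.toFinset.filter fun u => rk u < rk x).card) * sg l := by
  simp only [sg]
  congr 1
  induction l with
  | nil => simp
  | cons y l ih =>
    simp only [List.nodup_cons, List.mem_cons, not_or] at hl hx
    simp only [List.map_cons, List.prod_cons, List.toFinset_cons]
    rw [ih hl.2 hx.2, Finset.filter_insert]
    split_ifs with h
    · rw [Finset.card_insert_of_notMem (by simp [hl.1]), pow_succ,
        Int.sign_eq_neg_one_of_neg (by omega)]; ring
    · have : rk y ≠ rk x := fun h => hx.1 (rk_inj h.symm)
      rw [Int.sign_eq_one_of_pos (by omega)]; ring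

theorem Mt_iff {l : List E} (hl : l.Nodup) : Mt l ↔ K l.toFinset := by
  constructor
  · rintro h
    refine ⟨fun p hp => h.1 p (by simpa using hp), ?_⟩
    intro p hp q hq hpq
    simp only [List.mem_toFinset] at hp hq
    obtain ⟨l1, h1⟩ := List.perm_cons_erase hp |>.symm |> fun h => (⟨_, h⟩ : ∃ l1, (p :: l1).Perm l)
    have hm := Mt.perm h1.symm h
    rw [Mt.cons_iff] at hm
    have hq' : q ∈ l1 := by
      have := h1.mem_iff.2 hq
      rcases List.mem_cons.1 this with h | h
      · exact absurd h.symm hpq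
      · exact h
    have k1 : q.1 ∈ vs l1 := mem_vs.2 ⟨q, hq', Or.inl rfl⟩
    have k2 : q.2 ∈ vs l1 := mem_vs.2 ⟨q, hq', Or.inr rfl⟩
    refine ⟨?_, ?_, ?_, ?_⟩ <;> intro h <;> simp_all
  · rintro ⟨h1, h2⟩
    induction l with
    | nil => exact ⟨by simp, by simp [vs]⟩
    | cons p l ih =>
      rw [List.nodup_cons] at hl
      rw [Mt.cons_iff]
      refine ⟨h1 p (by simp), ?_, ?_, ih hl.2 (fun q hq => h1 q (by simp at hq; simp [hq]))
        (fun q hq r hr => h2 q (by simp at hq; simp [hq]) r (by simp at hr; simp [hr]))⟩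
      · rw [mem_vs]; rintro ⟨q, hq, h⟩
        have := h2 p (by simp) q (by simp [hq]) (by rintro rfl; exact hl.1 hq)
        tauto
      · rw [mem_vs]; rintro ⟨q, hq, h⟩
        have := h2 p (by simp) q (by simp [hq]) (by rintro rfl; exact hl.1 hq)
        tauto

open Classical in
/-- coefficient of a set -/
noncomputable def coef {c : ℕ} (z : C c) (τ : Finset E) : ℤ :=
  if h : K τ ∧ τ.card = c then z ⟨τ, h⟩ else 0

theorem coef_add {c : ℕ} (z z' : C c) (τ : Finset E) : coef (z + z') τ = coef z τ + coef z' τ := by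
  unfold coef; split_ifs <;> simp

theorem coef_smul {c : ℕ} (r : ℤ) (z : C c) (τ : Finset E) : coef (r • z) τ = r * coef z τ := by
  unfold coef; split_ifs <;> simp

noncomputable def hat {c : ℕ} (z : C c) (l : List E) : ℤ := sg l * coef z l.toFinset

theorem hat_add {c : ℕ} (z z' : C c) (l : List E) : hat (z + z') l = hat z l + hat z' l := by
  simp [hat, coef_add, mul_add]

theorem hat_smul {c : ℕ} (r : ℤ) (z : C c) (l : List E) : hat (r • z) l = r * hat z l := by
  simp only [hat, coef_smul]; ring

theorem hat_zero {c : ℕ} (l : List E) : hat (0 : C c) l = 0 := by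
  simpa using hat_smul (0 : ℤ) (0 : C c) l

theorem hat_sub {c : ℕ} (z z' : C c) (l : List E) : hat (z - z') l = hat z l - hat z' l := by
  have := hat_add (z - z') z' l
  rw [sub_add_cancel] at this; linarith

theorem hat_sum {c : ℕ} {ι : Type*} (s : Finset ι) (z : ι → C c) (l : List E) :
    hat (∑ i ∈ s, z i) l = ∑ i ∈ s, hat (z i) l := by
  classical
  induction s using Finset.induction_on with
  | empty => simp [hat_zero]
  | insert i s hi ih => rw [Finset.sum_insert hi, Finset.sum_insert hi, hat_add, ih]

theorem hat_good {c : ℕ} (z : C c) : Good Finset.univ c (hat z) := by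
  refine ⟨?_, ?_⟩
  · intro l1 x y l2
    simp only [hat]
    rw [sg_alt]
    have : (l1 ++ x :: y :: l2).toFinset = (l1 ++ y :: x :: l2).toFinset := by
      ext v; simp; tauto
    rw [this]; ring
  · intro l hl
    have h1 : l.Nodup := by
      by_contra h; exact hl (by simp [hat, sg_zero h])
    have h2 : K l.toFinset ∧ l.toFinset.card = c := by
      by_contra h; exact hl (by simp [hat, coef, h])
    exact ⟨(Mt_iff h1).2 h2.1, by rw [← h2.2, List.toFinset_card_of_nodup h1], by simp⟩

/-- chain associated with an alternating function -/
noncomputable def ofFun (c : ℕ) (Φ : List E → ℤ) : C c :=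
  Finsupp.equivFunOnFinite.symm (fun τ => sg τ.1.toList * Φ τ.1.toList)

theorem coef_ofFun {c : ℕ} (Φ : List E → ℤ) {τ : Finset E} (h : K τ ∧ τ.card = c) :
    coef (ofFun c Φ) τ = sg τ.toList * Φ τ.toList := by
  simp [coef, h, ofFun]

theorem hat_ofFun {c : ℕ} {Φ : List E → ℤ} (hΦ : Good Finset.univ c Φ) (l : List E) :
    hat (ofFun c Φ) l = Φ l := by
  by_cases h1 : l.Nodup
  · by_cases h2 : K l.toFinset ∧ l.toFinset.card = c
    · rw [hat, coef_ofFun _ h2]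
      have hp : l.toFinset.toList.Perm l := by
        rw [List.perm_ext_iff_of_nodup (Finset.nodup_toList _) h1]; simp
      have := Alt.perm_mul sg_alt hΦ.alt hp
      rw [this, ← mul_assoc, sg_sq h1, one_mul]
    · have : hat (ofFun c Φ) l = 0 := by simp [hat, coef, h2]
      rw [this]; symm; by_contra h
      obtain ⟨h3, h4, _⟩ := hΦ.supp l h
      exact h2 ⟨(Mt_iff h1).1 h3, by rw [List.toFinset_card_of_nodup h1, h4]⟩
  · have : hat (ofFun c Φ) l = 0 := by simp [hat, sg_zero h1]
    rw [this]; symm; by_contra h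
    exact h1 (hΦ.supp l h).1.nodup

theorem hat_toList {c : ℕ} (z : C c) (τ : {σ : Finset E // K σ ∧ σ.card = c}) :
    z τ = sg τ.1.toList * hat z τ.1.toList := by
  rw [hat, ← mul_assoc, sg_sq (Finset.nodup_toList _), one_mul]
  simp [coef, τ.2]

theorem hat_inj {c : ℕ} {z z' : C c} (h : ∀ l, hat z l = hat z' l) : z = z' := by
  ext τ
  rw [hat_toList, hat_toList, h]

theorem K_erase {σ : Finset E} (h : K σ) (v : E) : K (σ.erase v) :=
  ⟨fun p hp => h.1 p (Finset.mem_of_mem_erase hp),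
    fun p hp q hq => h.2 p (Finset.mem_of_mem_erase hp) q (Finset.mem_of_mem_erase hq)⟩

theorem coef_sum {c : ℕ} {ι : Type*} (s : Finset ι) (z : ι → C c) (τ : Finset E) :
    coef (∑ i ∈ s, z i) τ = ∑ i ∈ s, coef (z i) τ := by
  classical
  induction s using Finset.induction_on with
  | empty => simp [coef]
  | insert i s hi ih => rw [Finset.sum_insert hi, Finset.sum_insert hi, coef_add, ih]

theorem coef_single {c : ℕ} (σ : {σ : Finset E // K σ ∧ σ.card = c}) (r : ℤ) (τ : Finset E) :
    coef (Finsupp.single σ r : C c) τ = if σ.1 = τ then r else 0 := by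
  classical
  unfold coef
  split_ifs with h1 h2 h2
  · subst h2; simp
  · rw [Finsupp.single_apply, if_neg]; rintro rfl; exact h2 rfl
  · subst h2; exact absurd σ.2 h1
  · rfl

theorem coef_basisOrZero {c : ℕ} (σ τ : Finset E) (h : K σ ∧ σ.card = c) :
    coef (basisOrZero ℤ K c σ) τ = if σ = τ then 1 else 0 := by
  rw [basisOrZero, dif_pos h, coef_single]

theorem hat_bdry {c : ℕ} (z : C (c + 1)) (l : List E) : hat (D c z) l = bd (hat z) l := by
  induction z using Finsupp.induction_linear with
  | zero => simp [hat_zero, bd]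
  | add f g hf hg =>
    rw [map_add, hat_add, hf, hg]
    simp only [bd, hat_add, Finset.sum_add_distrib]
  | single σ r =>
    by_cases hl : l.Nodup
    · have e1 : D c (Finsupp.single σ r) = r • ∑ v ∈ σ.1,
        ((-1 : ℤ) ^ ((σ.1.filter fun u => rk u < rk v).card) • basisOrZero ℤ K c (σ.1.erase v)) := by
        simp [D, bdry]
      rw [e1, hat_smul, hat, coef_sum, bd]
      have e2 : ∀ x : E, hat (Finsupp.single σ r : C (c+1)) (x :: l)
          = if x ∈ σ.1 then (if σ.1.erase x = l.toFinset then sg (x :: l) * r else 0) else 0 := by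
        intro x
        rw [hat, coef_single]
        by_cases hx : x ∈ l
        · have : sg (x :: l) = 0 := sg_zero (by simp [hx])
          simp [this]
        · rw [List.toFinset_cons]
          by_cases hs : σ.1 = insert x l.toFinset
          · rw [if_pos hs, if_pos (by rw [hs]; simp), if_pos]
            rw [hs, Finset.erase_insert (by simpa using hx)]
          · rw [if_neg hs]
            split_ifs with h1 h2
            · exfalso; apply hs; rw [← h2, Finset.insert_erase h1]
            · simp
            · simp
      simp only [e2]
      rw [← Finset.sum_filter, Finset.mul_sum, Finset.mul_sum]
      have : Finset.univ.filter (fun a => a ∈ σ.1) = σ.1 := by ext; simp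
      rw [this]
      refine Finset.sum_congr rfl fun v hv => ?_
      have hk : K (σ.1.erase v) ∧ (σ.1.erase v).card = c :=
        ⟨K_erase σ.2.1 v, by rw [Finset.card_erase_of_mem hv, σ.2.2]; rfl⟩
      rw [coef_smul, coef_basisOrZero _ _ hk]
      split_ifs with h
      · have hvl : v ∉ l := by
          have : v ∉ l.toFinset := by rw [← h]; simp
          simpa using this
        rw [sg_cons hl hvl, ← h, Finset.filter_erase, Finset.erase_eq_of_notMem (by simp)]
        ring
      · simp
    · have z1 : hat (D c (Finsupp.single σ r)) l = 0 := by simp [hat, sg_zero hl]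
      rw [z1, bd]; symm
      apply Finset.sum_eq_zero
      intro x _
      simp [hat, sg_zero (show ¬ (x :: l).Nodup from fun h => hl (List.nodup_cons.1 h).2)]

theorem D_zero_iff {c : ℕ} (z : C (c + 1)) : D c z = 0 ↔ ∀ l, bd (hat z) l = 0 := by
  constructor
  · intro h l; rw [← hat_bdry, h, hat_zero]
  · intro h; apply hat_inj; intro l; rw [hat_bdry, h, hat_zero]

theorem DD {c : ℕ} (z : C (c + 1 + 1)) : D c (D (c + 1) z) = 0 := by
  rw [D_zero_iff]
  intro l
  simp only [bd, hat_bdry]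
  have h : ∑ x : E, ∑ y : E, hat z (y :: x :: l) = - ∑ x : E, ∑ y : E, hat z (y :: x :: l) := by
    conv_lhs => rw [Finset.sum_comm]
    rw [← Finset.sum_neg_distrib]
    refine Finset.sum_congr rfl fun x _ => ?_
    rw [← Finset.sum_neg_distrib]
    exact Finset.sum_congr rfl fun y _ => (hat_good z).alt.swap _ _ _
  omega

end MM


namespace MM
open MatchPaper

def prs (T : Finset V) : Finset E := Finset.univ.filter (fun x : E => x.1 < x.2 ∧ x.1 ∈ T ∧ x.2 ∈ T)

theorem card_prs (T : Finset V) : 2 * (prs T).card = T.card * T.card - T.card := by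
  rw [← Finset.offDiag_card]
  have h : T.offDiag = prs T ∪ (prs T).image Prod.swap := by
    ext ⟨a, b⟩
    simp only [Finset.mem_offDiag, prs, Finset.mem_union, Finset.mem_filter, Finset.mem_univ,
      true_and, Finset.mem_image, Prod.exists, Prod.swap_prod_mk, Prod.mk.injEq]
    constructor
    · rintro ⟨h1, h2, h3⟩
      rcases lt_or_gt_of_ne h3 with h | h
      · exact Or.inl ⟨h, h1, h2⟩
      · exact Or.inr ⟨b, a, ⟨h, h2, h1⟩, rfl, rfl⟩
    · rintro (⟨h1, h2, h3⟩ | ⟨x, y, ⟨h1, h2, h3⟩, rfl, rfl⟩)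
      · exact ⟨h2, h3, h1.ne⟩
      · exact ⟨h3, h2, h1.ne'⟩
  rw [h, Finset.card_union_of_disjoint, Finset.card_image_of_injective _ Prod.swap_injective]
  · ring
  · rw [Finset.disjoint_left]
    rintro ⟨a, b⟩ h1 h2
    simp only [prs, Finset.mem_filter, Finset.mem_univ,
      true_and, Finset.mem_image, Prod.exists, Prod.swap_prod_mk, Prod.mk.injEq] at h1 h2
    obtain ⟨x, y, ⟨h3, _⟩, rfl, rfl⟩ := h2
    exact absurd h1.1 (not_lt.2 h3.le)

open Classical in
noncomputable def Ms (c : ℕ) : Finset (Finset E) := Finset.univ.filter (fun σ => K σ ∧ σ.card = c)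

theorem mem_Ms {c : ℕ} {σ : Finset E} : σ ∈ Ms c ↔ K σ ∧ σ.card = c := by simp [Ms]

theorem Mt_toList {σ : Finset E} (h : K σ) : Mt σ.toList := by
  rw [Mt_iff (Finset.nodup_toList _)]; simpa using h

theorem Ms_rec (c m : ℕ) (hm : 2 * m = (13 - 2 * c) * (13 - 2 * c) - (13 - 2 * c)) :
    (Ms c).card * m = (Ms (c + 1)).card * (c + 1) := by
  classical
  apply Finset.card_mul_eq_card_mul (fun σ τ : Finset E => σ ⊆ τ)
  · intro σ hσ
    rw [mem_Ms] at hσ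
    have hf := free_card (S := Finset.univ) σ.toList (Mt_toList hσ.1) (by simp)
    have hl : σ.toList.length = c := by rw [Finset.length_toList, hσ.2]
    simp only [hl, Finset.card_univ, Fintype.card_fin] at hf
    have hp := card_prs (free Finset.univ σ.toList)
    have h13 : (free Finset.univ σ.toList).card = 13 - 2 * c := by omega
    rw [h13, ← hm] at hp
    have : m = (prs (free Finset.univ σ.toList)).card := by omega
    rw [this]
    have himg : (Ms (c + 1)).bipartiteAbove (fun σ τ : Finset E => σ ⊆ τ) σ
        = (prs (free Finset.univ σ.toList)).image (fun e => insert e σ) := by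
      ext τ
      simp only [Finset.mem_bipartiteAbove, mem_Ms, Finset.mem_image, prs, Finset.mem_filter,
        Finset.mem_univ, true_and, free, Finset.mem_sdiff, List.mem_toFinset]
      constructor
      · rintro ⟨⟨h1, h2⟩, h3⟩
        obtain ⟨e, he, heq⟩ := Finset.exists_eq_insert_iff.2 ⟨h3, by omega⟩
        refine ⟨e, ?_, heq⟩
        have hmt : Mt (e :: σ.toList) := by
          rw [Mt_iff (by simp [he, Finset.nodup_toList])]; simpa [heq] using h1
        rw [Mt.cons_iff] at hmt
        exact ⟨hmt.1, hmt.2.1, hmt.2.2.1⟩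
      · rintro ⟨e, ⟨h1, h2, h3⟩, rfl⟩
        have hmt : Mt (e :: σ.toList) := Mt.cons_iff.2 ⟨h1, h2, h3, Mt_toList hσ.1⟩
        have he : e ∉ σ := by simpa using (List.nodup_cons.1 hmt.nodup).1
        refine ⟨⟨?_, by rw [Finset.card_insert_of_notMem he, hσ.2]⟩, Finset.subset_insert _ _⟩
        rw [Mt_iff hmt.nodup] at hmt
        simpa using hmt
    rw [himg, Finset.card_image_of_injOn]
    intro e he e' he' heq
    simp only [prs, Finset.coe_filter, Set.mem_ofPred_eq, Finset.mem_univ, true_and, free,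
      Finset.mem_sdiff, List.mem_toFinset] at he he'
    have hn : e ∉ σ := fun h => he.2.1 (mem_vs.2 ⟨e, by simpa using h, Or.inl rfl⟩)
    have : e ∈ insert e' σ := (show insert e σ = insert e' σ from heq) ▸ Finset.mem_insert_self e σ
    rcases Finset.mem_insert.1 this with h | h
    · exact h
    · exact absurd h hn
  · intro τ hτ
    rw [mem_Ms] at hτ
    have himg : (Ms c).bipartiteBelow (fun σ τ : Finset E => σ ⊆ τ) τ = τ.image (fun e => τ.erase e) := by
      ext σ
      simp only [Finset.mem_bipartiteBelow, mem_Ms, Finset.mem_image]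
      constructor
      · rintro ⟨⟨h1, h2⟩, h3⟩
        obtain ⟨e, he, heq⟩ := Finset.exists_eq_insert_iff.2 ⟨h3, by omega⟩
        exact ⟨e, by rw [← heq]; simp, by rw [← heq, Finset.erase_insert he]⟩
      · rintro ⟨e, he, rfl⟩
        exact ⟨⟨K_erase hτ.1 e, by rw [Finset.card_erase_of_mem he, hτ.2]; rfl⟩, Finset.erase_subset _ _⟩
    rw [himg, Finset.card_image_of_injOn, hτ.2]
    intro e he e' he' heq
    by_contra hne
    have : e ∈ τ.erase e' := Finset.mem_erase.2 ⟨hne, he⟩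
    simp only at heq
    rw [← heq] at this
    simp at this

theorem Ms_rec' (c d m : ℕ) (hd : d = c + 1)
    (hm : 2 * m = (13 - 2 * c) * (13 - 2 * c) - (13 - 2 * c)) :
    (Ms c).card * m = (Ms d).card * d := by
  subst hd; exact Ms_rec c m hm

theorem Ms_zero : (Ms 0).card = 1 := by
  rw [Finset.card_eq_one]
  refine ⟨∅, ?_⟩
  ext σ
  simp only [mem_Ms, Finset.card_eq_zero, Finset.mem_singleton]
  constructor
  · exact fun h => h.2
  · rintro rfl; exact ⟨⟨by simp, by simp⟩, rfl⟩

theorem finrank_C (c : ℕ) : Module.finrank ℤ (C c) = (Ms c).card := by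
  classical
  rw [Module.finrank_finsupp_self, Ms, Fintype.card_subtype]

theorem card1 : (Ms 1).card = 78 := by
  have : (Ms 0).card * 78 = (Ms 1).card * 1 :=
    Ms_rec' 0 1 78 (by norm_num) (by norm_num)
  rw [Ms_zero] at this; omega
theorem card2 : (Ms 2).card = 2145 := by
  have : (Ms 1).card * 55 = (Ms 2).card * 2 :=
    Ms_rec' 1 2 55 (by norm_num) (by norm_num)
  rw [card1] at this; omega
theorem card3 : (Ms 3).card = 25740 := by
  have : (Ms 2).card * 36 = (Ms 3).card * 3 :=
    Ms_rec' 2 3 36 (by norm_num) (by norm_num)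
  rw [card2] at this; omega
theorem card4 : (Ms 4).card = 135135 := by
  have : (Ms 3).card * 21 = (Ms 4).card * 4 :=
    Ms_rec' 3 4 21 (by norm_num) (by norm_num)
  rw [card3] at this; omega
theorem card5 : (Ms 5).card = 270270 := by
  have : (Ms 4).card * 10 = (Ms 5).card * 5 :=
    Ms_rec' 4 5 10 (by norm_num) (by norm_num)
  rw [card4] at this; omega
theorem card6 : (Ms 6).card = 135135 := by
  have : (Ms 5).card * 3 = (Ms 6).card * 6 :=
    Ms_rec' 5 6 3 (by norm_num) (by norm_num)
  rw [card5] at this; omega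

end MM


namespace MM
open MatchPaper

/-- alternating sum over removal of an element -/
def Dg (H : E → List E → ℤ) : List E → ℤ
  | [] => 0
  | e :: l => H e l - Dg (fun y m => H y (e :: m)) l
termination_by l => l.length

theorem Dg_nil (H : E → List E → ℤ) : Dg H [] = 0 := by rw [Dg]
theorem Dg_cons (H : E → List E → ℤ) (e : E) (l : List E) :
    Dg H (e :: l) = H e l - Dg (fun y m => H y (e :: m)) l := by rw [Dg]

theorem Dg_add (H H' : E → List E → ℤ) (l : List E) :
    Dg (fun y m => H y m + H' y m) l = Dg H l + Dg H' l := by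
  induction l generalizing H H' with
  | nil => simp [Dg_nil]
  | cons e l ih => simp only [Dg_cons, ih]; ring

theorem Dg_smul (c : ℤ) (H : E → List E → ℤ) (l : List E) :
    Dg (fun y m => c * H y m) l = c * Dg H l := by
  induction l generalizing H with
  | nil => simp [Dg_nil]
  | cons e l ih => simp only [Dg_cons, ih]; ring

theorem Dg_zero (l : List E) : Dg (fun _ _ => 0) l = 0 := by
  have := Dg_smul 0 (fun _ _ => 0) l
  simpa using this

theorem Dg_neg (H : E → List E → ℤ) (l : List E) :
    Dg (fun y m => - H y m) l = - Dg H l := by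
  have := Dg_smul (-1) H l
  simpa using this

theorem Dg_sub (H H' : E → List E → ℤ) (l : List E) :
    Dg (fun y m => H y m - H' y m) l = Dg H l - Dg H' l := by
  simp only [sub_eq_add_neg, Dg_add, Dg_neg]

theorem Dg_sum {ι : Type*} (s : Finset ι) (H : ι → E → List E → ℤ) (l : List E) :
    Dg (fun y m => ∑ i ∈ s, H i y m) l = ∑ i ∈ s, Dg (H i) l := by
  classical
  induction s using Finset.induction_on with
  | empty => simp [Dg_zero]
  | insert i s hi ih => simp only [Finset.sum_insert hi, Dg_add, ih]

theorem Dg_congr {H H' : E → List E → ℤ} (l : List E)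
    (h : ∀ e r, (e :: r).Perm l → H e r = H' e r) : Dg H l = Dg H' l := by
  induction l generalizing H H' with
  | nil => simp [Dg_nil]
  | cons e l ih =>
    simp only [Dg_cons]
    rw [h e l (List.Perm.refl _)]
    congr 1
    apply ih
    intro y r hr
    exact h y (e :: r) ((List.Perm.swap _ _ _).trans (hr.cons e))

theorem Dg_self {F : List E → ℤ} (hF : Alt F) (l : List E) :
    Dg (fun e r => F (e :: r)) l = l.length * F l := by
  induction l generalizing F with
  | nil => simp [Dg_nil]
  | cons e l ih =>
    rw [Dg_cons]
    have : (fun y m => F (y :: e :: m)) = fun y m => - F (e :: y :: m) := by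
      funext y m; exact hF.swap _ _ _
    rw [this, Dg_neg, ih (hF.cons e)]
    push_cast [List.length_cons]; ring

theorem Dg_alt {F : List E → ℤ} (hF : Alt F) : Alt (Dg (fun _ m => F m)) := by
  intro l1 x y l2
  induction l1 generalizing F with
  | nil =>
    simp only [List.nil_append, Dg_cons]
    have : (fun (_ : E) m => F (x :: y :: m)) = fun _ m => - F (y :: x :: m) := by
      funext _ m; exact hF.swap _ _ _
    rw [this, Dg_neg]; ring
  | cons z l1 ih =>
    simp only [List.cons_append, Dg_cons]
    rw [hF l1 x y l2, ih (hF.cons z)]; ring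

theorem Dg_len {c : ℕ} {F : List E → ℤ} (h : ∀ l, F l ≠ 0 → l.length = c) (l : List E)
    (hl : Dg (fun _ m => F m) l ≠ 0) : l.length = c + 1 := by
  by_contra hne
  apply hl
  rw [Dg_congr (H' := fun _ _ => 0), Dg_zero]
  intro e r hr
  by_contra h0
  have := h r h0
  have := hr.length_eq
  simp at this
  omega

open Classical in
/-- coboundary -/
noncomputable def dl (F : List E → ℤ) (l : List E) : ℤ := if Mt l then Dg (fun _ m => F m) l else 0

theorem dl_good {c : ℕ} {F : List E → ℤ} (hF : Good Finset.univ c F) :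
    Good Finset.univ (c + 1) (dl F) := by
  refine ⟨?_, ?_⟩
  · intro l1 x y l2
    have hp : (l1 ++ x :: y :: l2).Perm (l1 ++ y :: x :: l2) :=
      List.Perm.append_left _ (List.Perm.swap _ _ _)
    have : Mt (l1 ++ x :: y :: l2) ↔ Mt (l1 ++ y :: x :: l2) := ⟨Mt.perm hp, Mt.perm hp.symm⟩
    simp only [dl, Dg_alt hF.alt l1 x y l2]
    by_cases h : Mt (l1 ++ y :: x :: l2) <;> simp [h, this]
  · intro l hl
    simp only [dl] at hl
    split_ifs at hl with h
    · exact ⟨h, Dg_len (fun l hl => (hF.supp l hl).2.1) l hl, by simp⟩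
    · simp at hl

/-- sums over lists of given length -/
def Sl : ℕ → (List E → ℤ) → ℤ
  | 0, G => G []
  | c + 1, G => ∑ x : E, Sl c (fun l => G (x :: l))

theorem Sl_add (c : ℕ) (F G : List E → ℤ) : Sl c (fun l => F l + G l) = Sl c F + Sl c G := by
  induction c generalizing F G with
  | zero => rfl
  | succ c ih => simp [Sl, ih, Finset.sum_add_distrib]

theorem Sl_smul (c : ℕ) (r : ℤ) (F : List E → ℤ) : Sl c (fun l => r * F l) = r * Sl c F := by
  induction c generalizing F with
  | zero => rfl
  | succ c ih => simp [Sl, ih, Finset.mul_sum]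

theorem Sl_sum {ι : Type*} (s : Finset ι) (c : ℕ) (F : ι → List E → ℤ) :
    Sl c (fun l => ∑ i ∈ s, F i l) = ∑ i ∈ s, Sl c (F i) := by
  induction c generalizing F with
  | zero => rfl
  | succ c ih => simp only [Sl, ih]; exact Finset.sum_comm

theorem Sl_nonneg (c : ℕ) (F : List E → ℤ) (h : ∀ l, 0 ≤ F l) : 0 ≤ Sl c F := by
  induction c generalizing F with
  | zero => exact h _
  | succ c ih => exact Finset.sum_nonneg fun x _ => ih _ fun l => h _

theorem Sl_zero_imp (c : ℕ) (F : List E → ℤ) (h : ∀ l, 0 ≤ F l) (h0 : Sl c F = 0) (l : List E)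
    (hl : l.length = c) : F l = 0 := by
  induction c generalizing F l with
  | zero => rw [List.length_eq_zero_iff] at hl; subst hl; exact h0
  | succ c ih =>
    match l, hl with
    | x :: l, hl =>
      have := (Finset.sum_eq_zero_iff_of_nonneg (fun x _ => Sl_nonneg c _ fun l => h (x :: l))).1 h0 x
        (Finset.mem_univ _)
      exact ih (fun l => F (x :: l)) (fun l => h _) this l (by simpa using hl)

theorem Sl_congr (c : ℕ) {F G : List E → ℤ} (h : ∀ l, l.length = c → F l = G l) :
    Sl c F = Sl c G := by
  induction c generalizing F G with
  | zero => exact h [] rfl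
  | succ c ih =>
    exact Finset.sum_congr rfl fun x _ => ih fun l hl => h _ (by simp [hl])

theorem Sl_Dg (c : ℕ) {F : List E → ℤ} (hF : Alt F) (H : E → List E → ℤ) :
    Sl (c + 1) (fun l => F l * Dg H l) = (c + 1) * Sl c (fun r => ∑ e : E, F (e :: r) * H e r) := by
  rw [Sl_sum]
  induction c generalizing F H with
  | zero => simp [Sl, Dg_cons, Dg_nil]
  | succ k ih =>
    have e1 : Sl (k + 1 + 1) (fun l => F l * Dg H l)
      = ∑ e : E, Sl (k + 1) (fun r => F (e :: r) * H e r)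
        + ∑ e : E, (-1) * Sl (k + 1) (fun r => F (e :: r) * Dg (fun y m => H y (e :: m)) r) := by
      rw [Sl, ← Finset.sum_add_distrib]
      refine Finset.sum_congr rfl fun e _ => ?_
      rw [← Sl_smul, ← Sl_add]
      congr 1; funext l; rw [Dg_cons]; ring
    rw [e1]
    have e2 : ∑ e : E, (-1) * Sl (k + 1) (fun r => F (e :: r) * Dg (fun y m => H y (e :: m)) r)
        = (k + 1) * ∑ e : E, Sl (k + 1) (fun r => F (e :: r) * H e r) := by
      have : ∀ e : E, (-1) * Sl (k + 1) (fun r => F (e :: r) * Dg (fun y m => H y (e :: m)) r)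
        = (k + 1) * ∑ y : E, Sl k (fun r => F (y :: e :: r) * H y (e :: r)) := by
        intro e
        rw [ih (hF.cons e), ← mul_assoc, mul_comm (-1 : ℤ), mul_assoc, Finset.mul_sum]
        congr 1
        refine Finset.sum_congr rfl fun y _ => ?_
        rw [← Sl_smul]
        congr 1; funext r; rw [hF.swap e y]; ring
      rw [Finset.sum_congr rfl fun e _ => this e, ← Finset.mul_sum, Finset.sum_comm]
      rfl
    rw [e2]; push_cast; ring

theorem sum_ind_mul (e x : E) (he : e.1 ≠ e.2) : mu e x = ∑ v : V, ind v e * ind v x := by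
  have : ∀ v : V, ind v e * ind v x = (if v = e.1 then ind v x else 0) + (if v = e.2 then ind v x else 0) := by
    intro v
    simp only [ind]
    by_cases h1 : v = e.1
    · have h2 : v ≠ e.2 := by rw [h1]; exact he
      simp [h1, he]
    · by_cases h2 : v = e.2 <;> simp [h1, h2, he.symm]
  simp only [this, Finset.sum_add_distrib, Finset.sum_ite_eq', Finset.mem_univ, if_true, mu]

theorem quad_nonneg (f : E → ℤ) (hf : ∀ x, f x ≠ 0 → x.1 ≠ x.2) :
    0 ≤ ∑ e : E, f e * ∑ x : E, mu e x * f x := by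
  have : ∑ e : E, f e * ∑ x : E, mu e x * f x = ∑ v : V, (∑ x : E, ind v x * f x) ^ 2 := by
    have h1 : ∀ e : E, f e * ∑ x : E, mu e x * f x = ∑ v : V, ∑ x : E, (ind v e * f e) * (ind v x * f x) := by
      intro e
      by_cases h0 : f e = 0
      · simp [h0]
      · rw [Finset.sum_comm, Finset.mul_sum]
        refine Finset.sum_congr rfl fun x _ => ?_
        rw [sum_ind_mul e x (hf e h0), Finset.sum_mul, Finset.mul_sum]
        exact Finset.sum_congr rfl fun v _ => by ring
    rw [Finset.sum_congr rfl fun e _ => h1 e, Finset.sum_comm]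
    refine Finset.sum_congr rfl fun v _ => ?_
    rw [sq, Finset.sum_mul_sum]
  rw [this]
  exact Finset.sum_nonneg fun v _ => sq_nonneg _

theorem garland {c m : ℕ} (hm : 2 * m = (13 - 2 * c) * (13 - 2 * c) - (13 - 2 * c)) (hcm : c < m)
    {F : List E → ℤ} (hF : Good Finset.univ c F) (hb : ∀ l, bd F l = 0)
    (hd : ∀ l, bd (dl F) l = 0) (l : List E) : F l = 0 := by
  classical
  have key : ∀ l, Mt l → l.length = c → (m : ℤ) * F l = c * F l
      - Dg (fun e r => ∑ x : E, mu e x * F (x :: r)) l := by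
    intro l hl hlc
    have h1 := hd l
    simp only [bd, dl, Dg_cons] at h1
    have hf := free_card (S := Finset.univ) l hl (by simp)
    simp only [hlc, Finset.card_univ, Fintype.card_fin] at hf
    have hp := card_prs (free Finset.univ l)
    have h13 : (free Finset.univ l).card = 13 - 2 * c := by omega
    rw [h13, ← hm] at hp
    have hmt : ∀ x : E, Mt (x :: l) ↔ x ∈ prs (free Finset.univ l) := by
      intro x
      rw [Mt.cons_iff]
      simp [prs, free, hl]
    simp only [hmt] at h1
    rw [← Finset.sum_filter, Finset.filter_univ_mem, Finset.sum_sub_distrib, Finset.sum_const,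
      nsmul_eq_mul, ← Dg_sum] at h1
    have hcard : ((prs (free Finset.univ l)).card : ℤ) = m := by omega
    rw [hcard] at h1
    have h2 : Dg (fun _ r => ∑ x ∈ prs (free Finset.univ l), F (x :: r)) l =
        Dg (fun e r => F (e :: r) - ∑ x : E, mu e x * F (x :: r)) l := by
      apply Dg_congr
      intro e r hr
      have hme : Mt (e :: r) := Mt.perm hr.symm hl
      have h3 : ∑ x ∈ prs (free Finset.univ l), F (x :: r)
          = ∑ x : E, ((if x = e then F (x :: r) else 0) + (F (x :: r) - mu e x * F (x :: r))) := by
        rw [← Finset.sum_filter_add_sum_filter_not Finset.univ (fun x => x ∈ prs (free Finset.univ l)),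
          Finset.filter_univ_mem]
        have hz : ∑ x ∈ Finset.univ.filter (fun x => x ∉ prs (free Finset.univ l)),
          ((if x = e then F (x :: r) else 0) + (F (x :: r) - mu e x * F (x :: r))) = 0 := by
          apply Finset.sum_eq_zero
          intro x hx
          by_cases h0 : F (x :: r) = 0
          · simp [h0]
          · have hxr := (hF.supp _ h0).1
            simp only [Finset.mem_filter, Finset.mem_univ, true_and, ← hmt] at hx
            rw [Mt.cons_iff] at hxr hme
            by_cases hxe : x = e
            · subst hxe
              simp [mu, ind]; ring
            · have hv : ∀ v, v ∈ vs l ↔ v = e.1 ∨ v = e.2 ∨ v ∈ vs r := by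
                intro v; rw [← (vs_perm hr).mem_iff]; simp [vs]
              have hor : (e.1 = x.1 ∨ e.1 = x.2) ∨ (e.2 = x.1 ∨ e.2 = x.2) := by
                by_contra hn
                apply hx
                rw [Mt.cons_iff]
                refine ⟨hxr.1, ?_, ?_, hl⟩ <;> rw [hv] <;> grind
              have hnot : ¬ ((e.1 = x.1 ∨ e.1 = x.2) ∧ (e.2 = x.1 ∨ e.2 = x.2)) := by
                rintro ⟨h1, h2⟩
                apply hxe
                rw [ed_eq hxr.1 e.1 e.2 hme.1.ne h1 h2]
                simp [ed, hme.1.le]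
              have : mu e x = 1 := by
                simp only [mu, ind]; split_ifs <;> first | rfl | tauto
              simp [hxe, this]
        rw [hz, add_zero]
        refine Finset.sum_congr rfl fun x hx => ?_
        rw [← hmt, Mt.cons_iff] at hx
        have hv : ∀ v, v ∈ vs l ↔ v = e.1 ∨ v = e.2 ∨ v ∈ vs r := by
          intro v; rw [← (vs_perm hr).mem_iff]; simp [vs]
        rw [hv, hv] at hx
        have h1 : mu e x = 0 := by
          simp only [mu, ind]
          rw [if_neg (by grind), if_neg (by grind)]; rfl
        rw [h1, if_neg (by rintro rfl; tauto)]; ring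
      rw [h3, Finset.sum_add_distrib, Finset.sum_sub_distrib]
      have : ∑ x : E, F (x :: r) = 0 := hb r
      rw [this, Finset.sum_ite_eq' Finset.univ e]
      simp [sub_eq_add_neg]
    rw [h2, Dg_sub, Dg_self hF.alt, hlc] at h1
    linarith
  have key2 : ((m : ℤ) - c) * Sl c (fun l => F l * F l)
      = - Sl c (fun l => F l * Dg (fun e r => ∑ x : E, mu e x * F (x :: r)) l) := by
    rw [← Sl_smul, neg_eq_neg_one_mul, ← Sl_smul]
    apply Sl_congr
    intro l hl
    by_cases h0 : F l = 0
    · simp [h0]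
    · have := key l (hF.supp l h0).1 hl
      linear_combination F l * this
  have key3 : 0 ≤ Sl c (fun l => F l * Dg (fun e r => ∑ x : E, mu e x * F (x :: r)) l) := by
    cases c with
    | zero => simp [Sl, Dg_nil]
    | succ c =>
      rw [Sl_Dg _ hF.alt]
      apply mul_nonneg (by positivity)
      apply Sl_nonneg
      intro r
      apply quad_nonneg (fun e => F (e :: r))
      intro x hx
      exact (Mt.cons_iff.1 (hF.supp _ hx).1).1.ne
  have key4 : Sl c (fun l => F l * F l) = 0 := by
    have h1 : 0 ≤ Sl c (fun l => F l * F l) := Sl_nonneg _ _ fun l => mul_self_nonneg _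
    have h2 : (1 : ℤ) ≤ (m : ℤ) - c := by omega
    nlinarith
  by_contra h0
  have := Sl_zero_imp c _ (fun l => mul_self_nonneg (F l)) key4 l (hF.supp l h0).2.1
  exact h0 (mul_self_eq_zero.1 this)

/-- coboundary as a linear map -/
noncomputable def T (c : ℕ) : C c →ₗ[ℤ] C (c + 1) where
  toFun z := ofFun (c + 1) (dl (hat z))
  map_add' z z' := by
    apply hat_inj; intro l
    rw [hat_add, hat_ofFun (dl_good (hat_good _)), hat_ofFun (dl_good (hat_good _)),
      hat_ofFun (dl_good (hat_good _))]
    simp only [dl, hat_add, Dg_add]; split_ifs <;> simp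
  map_smul' r z := by
    apply hat_inj; intro l
    rw [RingHom.id_apply, hat_smul, hat_ofFun (dl_good (hat_good _)), hat_ofFun (dl_good (hat_good _))]
    simp only [dl, hat_smul, Dg_smul]; split_ifs <;> simp

theorem hat_T {c : ℕ} (z : C c) (l : List E) : hat (T c z) l = dl (hat z) l :=
  hat_ofFun (dl_good (hat_good _)) l

theorem mem_cyc {c : ℕ} (z : C c) : z ∈ cycLow ℤ rk K c ↔ ∀ l, bd (hat z) l = 0 := by
  cases c with
  | zero =>
    simp only [cycLow, Submodule.mem_top, true_iff]
    intro l
    apply Finset.sum_eq_zero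
    intro x _
    by_contra h
    have := ((hat_good z).supp _ h).2.1
    simp at this
  | succ c =>
    rw [cycLow, LinearMap.mem_ker]; exact D_zero_iff z

theorem range_le_cyc (c : ℕ) : LinearMap.range (D c) ≤ cycLow ℤ rk K c := by
  cases c with
  | zero => exact le_top
  | succ c =>
    rintro _ ⟨z, rfl⟩
    exact LinearMap.mem_ker.2 (DD z)

theorem finrank_cyc {c m : ℕ} (hm : 2 * m = (13 - 2 * c) * (13 - 2 * c) - (13 - 2 * c)) (hcm : c < m) :
    Module.finrank ℤ (cycLow ℤ rk K c) = Module.finrank ℤ (LinearMap.range (D c)) := by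
  apply le_antisymm
  · let g : cycLow ℤ rk K c →ₗ[ℤ] LinearMap.range (D c) :=
      (D c).rangeRestrict ∘ₗ (T c) ∘ₗ (cycLow ℤ rk K c).subtype
    apply LinearMap.finrank_le_finrank_of_injective (f := g)
    rw [← LinearMap.ker_eq_bot, LinearMap.ker_eq_bot']
    rintro ⟨z, hz⟩ h
    have h1 : D c (T c z) = 0 := congrArg Subtype.val h
    rw [D_zero_iff] at h1
    rw [mem_cyc] at hz
    have h2 := garland hm hcm (hat_good z) hz (by
      intro l; rw [← h1 l]; simp only [bd, hat_T])
    apply Subtype.ext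
    apply hat_inj
    intro l; rw [h2]; exact (hat_zero l).symm
  · exact Submodule.finrank_mono (range_le_cyc c)

theorem rank_null (c : ℕ) : Module.finrank ℤ (LinearMap.range (D c)) +
    Module.finrank ℤ (cycLow ℤ rk K (c + 1)) = (Ms (c + 1)).card := by
  have h : cycLow ℤ rk K (c + 1) = LinearMap.ker (D c) := rfl
  rw [h, ← finrank_C, ← (LinearMap.ker (D c)).finrank_quotient_add_finrank,
    (D c).quotKerEquivRange.finrank_eq]

theorem rank_null' (c d : ℕ) (h : d = c + 1) : Module.finrank ℤ (LinearMap.range (D c)) +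
    Module.finrank ℤ (cycLow ℤ rk K d) = (Ms d).card := by
  subst h; exact rank_null c

theorem rank_cyc5 : Module.finrank ℤ (cycLow ℤ rk K 5) = 158807 := by
  have h0 : Module.finrank ℤ (cycLow ℤ rk K 0) = 1 := by
    have : cycLow ℤ rk K 0 = ⊤ := rfl
    rw [this, finrank_top]
    exact (finrank_C 0).trans Ms_zero
  have a0 := finrank_cyc (c := 0) (m := 78) (by norm_num) (by norm_num)
  have a1 := finrank_cyc (c := 1) (m := 55) (by norm_num) (by norm_num)
  have a2 := finrank_cyc (c := 2) (m := 36) (by norm_num) (by norm_num)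
  have a3 := finrank_cyc (c := 3) (m := 21) (by norm_num) (by norm_num)
  have a4 := finrank_cyc (c := 4) (m := 10) (by norm_num) (by norm_num)
  have b0 := rank_null' 0 1 (by norm_num)
  have b1 := rank_null' 1 2 (by norm_num)
  have b2 := rank_null' 2 3 (by norm_num)
  have b3 := rank_null' 3 4 (by norm_num)
  have b4 := rank_null' 4 5 (by norm_num)
  rw [card1] at b0
  rw [card2] at b1
  rw [card3] at b2
  rw [card4] at b3
  rw [card5] at b4
  omega

end MM


namespace MM
open MatchPaper

def Gf (e x : E) : ℤ := 13 * mu e x - 4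

def gv (v : V) (x : E) : ℤ := 13 * ind v x - 2

theorem Gf_eq (e x : E) : Gf e x = gv e.1 x + gv e.2 x := by simp [Gf, gv, mu]; ring

theorem sum_prs (T : Finset V) (g : V → ℤ) :
    ∑ x ∈ prs T, (g x.1 + g x.2) = (T.card - 1 : ℤ) * ∑ v ∈ T, g v := by
  have h1 : ∑ x ∈ prs T, g x.2 = ∑ x ∈ (T ×ˢ T).filter (fun x => x.2 < x.1), g x.1 := by
    apply Finset.sum_nbij' Prod.swap Prod.swap <;> simp [prs] <;> tauto
  have h2 : prs T = (T ×ˢ T).filter (fun x => x.1 < x.2) := by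
    ext x; simp [prs]; tauto
  rw [Finset.sum_add_distrib, h1, h2]
  have h3 : ∑ x ∈ T ×ˢ T, g x.1 = ∑ x ∈ (T ×ˢ T).filter (fun x => x.1 < x.2), g x.1 +
      ∑ x ∈ (T ×ˢ T).filter (fun x => x.2 < x.1), g x.1 + ∑ v ∈ T, g v := by
    rw [← Finset.sum_filter_add_sum_filter_not (T ×ˢ T) (fun x => x.1 < x.2), add_assoc]
    congr 1
    rw [← Finset.sum_filter_add_sum_filter_not _ (fun x : V × V => x.2 < x.1)]
    congr 1
    · apply Finset.sum_congr _ fun _ _ => rfl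
      ext x; simp only [Finset.mem_filter, not_lt]
      constructor
      · rintro ⟨⟨h1, h2⟩, h3⟩; exact ⟨h1, h3⟩
      · rintro ⟨h1, h3⟩; exact ⟨⟨h1, h3.le⟩, h3⟩
    · apply Finset.sum_nbij' (fun x : V × V => x.1) (fun v => (v, v))
      · simp; tauto
      · simp
      · rintro ⟨a, b⟩ h
        simp only [Finset.mem_filter, not_lt] at h
        have := le_antisymm h.1.2 h.2
        simp [this]
      · simp
      · simp
  rw [Finset.sum_product] at h3
  simp only [Finset.sum_const, nsmul_eq_mul, ← Finset.mul_sum] at h3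
  linarith

theorem sum_gv (y : E) (hy : y.1 ≠ y.2) : ∑ v : V, gv v y = 0 := by
  have : ∀ v : V, gv v y = 13 * ((if v = y.1 then 1 else 0) + (if v = y.2 then 1 else 0)) - 2 := by
    intro v
    simp only [gv, ind]
    by_cases h1 : v = y.1
    · simp [h1, hy]
    · by_cases h2 : v = y.2 <;> simp [h1, h2, hy.symm]
  simp only [this, Finset.sum_sub_distrib, ← Finset.mul_sum, Finset.sum_add_distrib,
    Finset.sum_ite_eq', Finset.mem_univ, if_true]
  simp

theorem sum_vs (l : List E) (y : E) : ((vs l).map (fun v => gv v y)).sum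
    = (l.map (fun x => Gf x y)).sum := by
  induction l with
  | nil => rfl
  | cons e l ih => simp [vs, ih, Gf_eq, add_assoc]

theorem sum_free (l : List E) (hl : Mt l) (hl5 : l.length = 5) (y : E) (hy : y.1 ≠ y.2) :
    ∑ x ∈ prs (free Finset.univ l), Gf x y = (-2) * (l.map (fun x => Gf x y)).sum := by
  have h0 := free_card (S := Finset.univ) l hl (by simp)
  rw [hl5] at h0
  simp only [Finset.card_univ, Fintype.card_fin] at h0
  simp only [Gf_eq]
  rw [sum_prs (free Finset.univ l) (fun v => gv v y)]
  have h1 := sum_gv y hy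
  have h2 : (free Finset.univ l).card = 3 := by omega
  rw [h2]
  have h3 := Finset.sum_sdiff (f := fun v => gv v y) (Finset.subset_univ (vs l).toFinset)
  rw [h1, List.sum_toFinset _ hl.2, sum_vs] at h3
  simp only [Gf_eq] at h3
  rw [free]
  push_cast
  linarith

theorem Sm_head_congr {h h' : E → ℤ} (hs : List (E → ℤ)) {F : List E → ℤ}
    (H : ∀ x l, F (x :: l) ≠ 0 → h x = h' x) : Sm (h :: hs) F = Sm (h' :: hs) F := by
  rw [Sm_cons', Sm_cons']
  congr 1; funext l
  refine Finset.sum_congr rfl fun x _ => ?_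
  by_cases h0 : F (x :: l) = 0
  · simp [h0]
  · rw [H x l h0]

theorem Sm_head_list {F : List E → ℤ} (hF : Alt F) (l l' : List E) (h : ∀ x ∈ l', x ∈ l) :
    Sm ((fun y => (l'.map (fun x => Gf x y)).sum) :: l.map Gf) F = 0 := by
  induction l' with
  | nil => simp [Sm]
  | cons e l' ih =>
    simp only [List.map_cons, List.sum_cons]
    rw [Sm_head_add (Gf e) (fun y => (l'.map (fun x => Gf x y)).sum),
      ih (fun x hx => h x (by simp [hx]))]
    have := (Sm_alt hF).mem_zero (Gf e) (l.map Gf) (List.mem_map_of_mem (h e (by simp)))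
    simpa using this

theorem Sm_head_sum {ι : Type*} (s : Finset ι) (f : ι → E → ℤ) (hs : List (E → ℤ)) (F : List E → ℤ) :
    Sm ((fun y => ∑ i ∈ s, f i y) :: hs) F = ∑ i ∈ s, Sm (f i :: hs) F := by
  simp only [Sm, Finset.sum_mul]
  exact Finset.sum_comm

open Classical in
noncomputable def Pf (F : List E → ℤ) (l : List E) : ℤ :=
  if Mt l ∧ l.length = 6 then Sm (l.map Gf) F else 0

theorem Pf_good {F : List E → ℤ} (hF : Alt F) : Good Finset.univ 6 (Pf F) := by
  refine ⟨?_, ?_⟩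
  · intro l1 x y l2
    have hp : (l1 ++ x :: y :: l2).Perm (l1 ++ y :: x :: l2) :=
      List.Perm.append_left _ (List.Perm.swap _ _ _)
    have h1 : Mt (l1 ++ x :: y :: l2) ↔ Mt (l1 ++ y :: x :: l2) := ⟨Mt.perm hp, Mt.perm hp.symm⟩
    have h2 := hp.length_eq
    have h3 := Sm_alt hF (l1.map Gf) (Gf x) (Gf y) (l2.map Gf)
    have h4 : Mt (l1 ++ x :: y :: l2) ∧ (l1 ++ x :: y :: l2).length = 6 ↔
        Mt (l1 ++ y :: x :: l2) ∧ (l1 ++ y :: x :: l2).length = 6 := by rw [h1, h2]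
    by_cases h : Mt (l1 ++ y :: x :: l2) ∧ (l1 ++ y :: x :: l2).length = 6
    · rw [Pf, Pf, if_pos h, if_pos (h4.2 h)]
      simpa using h3
    · rw [Pf, Pf, if_neg h, if_neg (fun h' => h (h4.1 h'))]; simp
  · intro l hl
    simp only [Pf] at hl
    split_ifs at hl with h
    · exact ⟨h.1, h.2, by simp⟩
    · simp at hl

theorem Pf_bd {F : List E → ℤ} (hF : Good Finset.univ 6 F) (l : List E) : bd (Pf F) l = 0 := by
  classical
  by_cases h : Mt l ∧ l.length = 5
  · have hmt : ∀ x : E, Mt (x :: l) ∧ (x :: l).length = 6 ↔ x ∈ prs (free Finset.univ l) := by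
      intro x
      rw [Mt.cons_iff]
      simp [prs, free, h]
    simp only [bd, Pf, hmt]
    rw [← Finset.sum_filter, Finset.filter_univ_mem]
    simp only [List.map_cons]
    rw [← Sm_head_sum, Sm_head_congr (h' := fun y => (-2) * (l.map (fun x => Gf x y)).sum),
      Sm_head_smul, Sm_head_list hF.alt l l (fun _ h => h), mul_zero]
    intro y m hm
    exact sum_free l h.1 h.2 y (Mt.cons_iff.1 (hF.supp _ hm).1).1.ne
  · apply Finset.sum_eq_zero
    intro x _
    by_contra h0
    have h1 := (Pf_good hF.alt).supp _ h0
    exact h ⟨h1.1.tail, by simpa using h1.2.1⟩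

theorem bd_cons {F : List E → ℤ} (hF : Alt F) (hb : ∀ l, bd F l = 0) (x : E) (l : List E) :
    bd (fun m => F (x :: m)) l = 0 := by
  have := hb (x :: l)
  simp only [bd] at this ⊢
  rw [← neg_eq_zero, ← this, ← Finset.sum_neg_distrib]
  exact Finset.sum_congr rfl fun y _ => (hF.swap y x l).symm

theorem Sm_drop (a b : ℤ) (f : E → E → ℤ) (l : List E) {F : List E → ℤ} (hF : Alt F)
    (hb : ∀ l, bd F l = 0) :
    Sm (l.map (fun e x => a * f e x + b)) F = a ^ l.length * Sm (l.map f) F := by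
  induction l generalizing F with
  | nil => simp
  | cons e l ih =>
    simp only [List.map_cons]
    rw [Sm_head_add (fun x => a * f e x) (fun _ => b), Sm_head_const _ _ _ hb, add_zero, Sm_head_smul]
    simp only [Sm]
    rw [List.length_cons, pow_succ, mul_comm _ a, mul_assoc, Finset.mul_sum (a := a ^ _)]
    congr 1
    refine Finset.sum_congr rfl fun x _ => ?_
    rw [ih (hF.cons x) (bd_cons hF hb x)]; ring

theorem Pf_cyc {F : List E → ℤ} (hF : Good Finset.univ 6 F) (hb : ∀ l, bd F l = 0) (l : List E) :
    Pf F l = 13 ^ 6 * 720 * F l := by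
  by_cases h : Mt l ∧ l.length = 6
  · rw [Pf, if_pos h]
    have h1 := Sm_drop 13 (-4) mu l hF.alt hb
    have h2 : (fun e x => 13 * mu e x + (-4)) = Gf := by funext e x; simp [Gf]; ring
    rw [h2] at h1
    rw [h1, main_b 6 Finset.univ F (by simp) hF hb l h.1 h.2 (by simp), h.2]
    norm_num [Nat.factorial]; ring
  · rw [Pf, if_neg h]
    have : F l = 0 := by
      by_contra h0
      have := hF.supp l h0
      exact h ⟨this.1, this.2.1⟩
    rw [this, mul_zero]

def dlt (e x : E) : ℤ := if x = e then 1 else 0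

theorem Sm_dlt (l : List E) (F : List E → ℤ) : Sm (l.map dlt) F = F l := by
  induction l generalizing F with
  | nil => rfl
  | cons e l ih => simp [Sm, ih, dlt]

theorem bd_bd {F : List E → ℤ} (hF : Alt F) (l : List E) : bd (bd F) l = 0 := by
  simp only [bd]
  have h : ∑ x : E, ∑ y : E, F (y :: x :: l) = - ∑ x : E, ∑ y : E, F (y :: x :: l) := by
    conv_lhs => rw [Finset.sum_comm]
    rw [← Finset.sum_neg_distrib]
    refine Finset.sum_congr rfl fun x _ => ?_
    rw [← Finset.sum_neg_distrib]
    exact Finset.sum_congr rfl fun y _ => hF.swap _ _ _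
  omega

theorem bd_alt {F : List E → ℤ} (hF : Alt F) : Alt (bd F) := by
  intro l1 x y l2
  simp only [bd]
  rw [← Finset.sum_neg_distrib]
  exact Finset.sum_congr rfl fun z _ => hF (z :: l1) x y l2

theorem Sm_diag (a b : ℤ) (l : List E) (hl : l.Nodup) {F : List E → ℤ} (hF : Alt F)
    (hs : ∀ m, F m ≠ 0 → m.Perm l) :
    a * Sm (l.map (fun e x => a * dlt e x + b)) F = a ^ l.length * (a + l.length * b) * F l := by
  induction l generalizing F with
  | nil => simp [Sm]
  | cons e l ih =>
    rw [List.nodup_cons] at hl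
    have h1 : bd F l = F (e :: l) := by
      rw [bd, Finset.sum_eq_single e]
      · intro x _ hx
        by_contra h0
        have := (hs _ h0).mem_iff (a := x)
        have h2 : x ∈ l := by simpa [hx] using this
        have h3 := (hs _ h0).nodup_iff.2 (List.nodup_cons.2 hl)
        exact (List.nodup_cons.1 h3).1 h2
      · simp
    simp only [List.map_cons]
    rw [Sm_head_add (fun x => a * dlt e x) (fun _ => b), Sm_head_smul]
    have h2 : Sm ((fun _ => b) :: l.map (fun e x => a * dlt e x + b)) F
        = b * (a ^ l.length * F (e :: l)) := by
      have : (fun _ : E => b) = fun x => b * (fun _ => (1 : ℤ)) x := by simp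
      rw [this, Sm_head_smul, Sm_cons']
      have h3 : (fun m => ∑ x : E, 1 * F (x :: m)) = bd F := by funext m; simp [bd]
      rw [h3, Sm_drop a b dlt l (bd_alt hF) (bd_bd hF), Sm_dlt, h1]
    have h3 : Sm (dlt e :: l.map (fun e x => a * dlt e x + b)) F =
        Sm (l.map (fun e x => a * dlt e x + b)) (fun m => F (e :: m)) := by
      simp [Sm, dlt]
    have h4 := ih hl.2 (hF.cons e) (fun m hm => (List.perm_cons e).1 (hs _ hm))
    rw [h2, h3, mul_add, h4, List.length_cons]
    push_cast; ring

theorem Sm_congr (l : List E) (L : List E) (f f' : E → E → ℤ)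
    (h : ∀ e ∈ l, ∀ x ∈ L, f e x = f' e x) {F : List E → ℤ} (hF : ∀ m, F m ≠ 0 → ∀ x ∈ m, x ∈ L) :
    Sm (l.map f) F = Sm (l.map f') F := by
  induction l generalizing F with
  | nil => rfl
  | cons e l ih =>
    simp only [List.map_cons, Sm]
    refine Finset.sum_congr rfl fun x _ => ?_
    rw [ih (fun e he => h e (by simp [he])) (fun m hm y hy => hF _ hm y (by simp [hy]))]
    by_cases hx : x ∈ L
    · rw [h e (by simp) x hx]
    · have : (fun m => F (x :: m)) = fun _ => 0 := by
        funext m; by_contra h0; exact hx (hF _ h0 x (by simp))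
      rw [this, Sm_zero]; simp

theorem Sm_Gf_diag (l : List E) (hl : Mt l) (h6 : l.length = 6) {F : List E → ℤ} (hF : Alt F)
    (hs : ∀ m, F m ≠ 0 → m.Perm l) : Sm (l.map Gf) F = 2 * 26 ^ 5 * F l := by
  have h1 : Sm (l.map Gf) F = Sm (l.map (fun e x => 26 * dlt e x + (-4))) F := by
    apply Sm_congr l l
    · intro e he x hx
      by_cases hxe : x = e
      · subst hxe; simp [Gf, mu, ind, dlt]
      · have hk := ((Mt_iff hl.nodup).1 hl).2 e (by simpa) x (by simpa) (fun h => hxe h.symm)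
        simp [Gf, mu, ind, dlt, hxe, hk]
    · intro m hm x hx; exact (hs m hm).mem_iff.1 hx
  have h2 := Sm_diag 26 (-4) l hl.nodup hF hs
  rw [h6] at h2
  rw [h1]
  norm_num at h2 ⊢
  linarith

noncomputable def P : C 6 →ₗ[ℤ] C 6 where
  toFun z := ofFun 6 (Pf (hat z))
  map_add' z z' := by
    apply hat_inj; intro l
    rw [hat_add, hat_ofFun (Pf_good (hat_good _).alt), hat_ofFun (Pf_good (hat_good _).alt),
      hat_ofFun (Pf_good (hat_good _).alt)]
    have : hat (z + z') = fun l => hat z l + hat z' l := by funext l; exact hat_add z z' l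
    simp only [Pf, this, Sm_add]; split_ifs <;> simp
  map_smul' r z := by
    apply hat_inj; intro l
    rw [RingHom.id_apply, hat_smul, hat_ofFun (Pf_good (hat_good _).alt),
      hat_ofFun (Pf_good (hat_good _).alt)]
    have : hat (r • z) = fun l => r * hat z l := by funext l; exact hat_smul r z l
    simp only [Pf, this, Sm_smul]; split_ifs <;> simp

theorem hat_P (z : C 6) (l : List E) : hat (P z) l = Pf (hat z) l :=
  hat_ofFun (Pf_good (hat_good _).alt) l

theorem P_mem (z : C 6) : P z ∈ cycLow ℤ rk K 6 := by
  rw [mem_cyc]; intro l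
  have : hat (P z) = Pf (hat z) := by funext l; exact hat_P z l
  rw [this, Pf_bd (hat_good z)]

theorem P_cyc (z : C 6) (hz : z ∈ cycLow ℤ rk K 6) : P z = (13 ^ 6 * 720 : ℤ) • z := by
  rw [mem_cyc] at hz
  apply hat_inj; intro l
  rw [hat_P, Pf_cyc (hat_good z) hz, hat_smul]

theorem P_diag (τ : {σ : Finset E // K σ ∧ σ.card = 6}) :
    (P (Finsupp.single τ 1)) τ = 2 * 26 ^ 5 := by
  rw [hat_toList, hat_P, Pf]
  have hm := Mt_toList τ.2.1
  have h6 : τ.1.toList.length = 6 := by rw [Finset.length_toList, τ.2.2]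
  rw [if_pos ⟨hm, h6⟩, Sm_Gf_diag _ hm h6 (hat_good _).alt]
  · rw [hat, coef_single]
    have := sg_sq hm.nodup
    simp only [Finset.toList_toFinset, if_true]
    linear_combination (2 * 26 ^ 5) * this
  · intro m hm'
    have h1 := ((hat_good _).supp m hm').1.nodup
    rw [hat, coef_single] at hm'
    have h2 : τ.1 = m.toFinset := by by_contra h; simp [h] at hm'
    rw [List.perm_ext_iff_of_nodup h1 hm.nodup]
    simp [h2]

theorem trace_P : LinearMap.trace ℤ (C 6) P = 135135 * (2 * 26 ^ 5) := by
  classical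
  rw [LinearMap.trace_eq_matrix_trace ℤ (Finsupp.basisSingleOne), Matrix.trace]
  have : ∀ τ, (LinearMap.toMatrix Finsupp.basisSingleOne Finsupp.basisSingleOne P).diag τ
      = 2 * 26 ^ 5 := by
    intro τ
    rw [Matrix.diag_apply, LinearMap.toMatrix_apply]
    simp only [Finsupp.coe_basisSingleOne, Finsupp.basisSingleOne_repr, LinearEquiv.refl_apply]
    exact P_diag τ
  rw [Finset.sum_congr rfl fun τ _ => this τ, Finset.sum_const, nsmul_eq_mul, Finset.card_univ]
  have h := card6
  rw [Ms, ← Fintype.card_subtype] at h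
  rw [Fintype.card_eq_nat_card] at h ⊢
  rw [h]; norm_num

theorem rank_cyc6 : Module.finrank ℤ (cycLow ℤ rk K 6) = 924 := by
  have h1 := LinearMap.trace_restrict_eq_of_forall_mem (cycLow ℤ rk K 6) P P_mem
  rw [trace_P] at h1
  have h2 : P.restrict (p := cycLow ℤ rk K 6) (q := cycLow ℤ rk K 6) (fun x _ => P_mem x)
      = (13 ^ 6 * 720 : ℤ) • LinearMap.id := by
    ext1 z
    apply Subtype.ext
    exact P_cyc z.1 z.2
  rw [h2, map_smul, LinearMap.trace_id] at h1
  simp only [smul_eq_mul] at h1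
  have : (Module.finrank ℤ (cycLow ℤ rk K 6) : ℤ) = 924 := by norm_num at h1 ⊢; linarith
  exact_mod_cast this

end MM


set_option linter.unusedSimpArgs false
namespace MM
open MatchPaper

abbrev N2 := ℕ × ℕ

/-- contraction operator -/
def Op (k : N2 → Option ℕ) : List N2 → (ℕ → List N2 → ℤ) → ℤ
  | [], _ => 0
  | e :: l, G => (match k e with | some x => G x l | none => 0) - Op k l (fun x m => G x (e :: m))

theorem Op_zero (k : N2 → Option ℕ) (l : List N2) {G : ℕ → List N2 → ℤ} (hG : ∀ x m, G x m = 0) :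
    Op k l G = 0 := by
  induction l generalizing G with
  | nil => rfl
  | cons e l ih =>
    rw [Op, ih (fun x m => hG _ _)]
    cases k e <;> simp [hG]

theorem Op_neg (k : N2 → Option ℕ) (l : List N2) (G : ℕ → List N2 → ℤ) :
    Op k l (fun x m => - G x m) = - Op k l G := by
  induction l generalizing G with
  | nil => rfl
  | cons e l ih =>
    simp only [Op]
    rw [ih]
    cases k e <;> simp; ring

theorem Op_none (k : N2 → Option ℕ) (l : List N2) (G : ℕ → List N2 → ℤ) (h : ∀ e ∈ l, k e = none) :
    Op k l G = 0 := by
  induction l generalizing G with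
  | nil => rfl
  | cons e l ih =>
    rw [Op, ih _ (fun e he => h e (by simp [he])), h e (by simp)]; rfl

theorem Op_alt (k : N2 → Option ℕ) {G : ℕ → List N2 → ℤ} (hG : ∀ x, Alt (G x)) :
    Alt (fun l => Op k l G) := by
  intro l1 x y l2
  simp only
  induction l1 generalizing G with
  | nil =>
    simp only [List.nil_append, Op]
    have : (fun u m => G u (x :: y :: m)) = fun u m => - G u (y :: x :: m) := by
      funext u m; exact (hG u).swap _ _ _
    rw [this, Op_neg]
    ring
  | cons z l1 ih =>
    simp only [List.cons_append, Op]
    rw [ih (fun u => (hG u).cons z)]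
    cases k z with
    | none => simp
    | some u => simp only [hG u l1 x y l2]; ring

/-- symmetric in each pair -/
def Sy (F : List N2 → ℤ) : Prop := ∀ l1 x y l2, F (l1 ++ (x, y) :: l2) = F (l1 ++ (y, x) :: l2)

theorem Sy.cons {F : List N2 → ℤ} (h : Sy F) (e : N2) : Sy (fun l => F (e :: l)) :=
  fun l1 x y l2 => h (e :: l1) x y l2

theorem Sy.head {F : List N2 → ℤ} (h : Sy F) (x y : ℕ) (l : List N2) : F ((x, y) :: l) = F ((y, x) :: l) :=
  h [] x y l

theorem Op_sy (k : N2 → Option ℕ) (hk : ∀ x y, k (x, y) = k (y, x)) {G : ℕ → List N2 → ℤ}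
    (hG : ∀ x, Sy (G x)) : Sy (fun l => Op k l G) := by
  intro l1 x y l2
  simp only
  induction l1 generalizing G with
  | nil =>
    simp only [List.nil_append, Op]
    have : (fun u m => G u ((x, y) :: m)) = fun u m => G u ((y, x) :: m) := by
      funext u m; exact (hG u).head _ _ _
    rw [this, hk]
  | cons z l1 ih =>
    simp only [List.cons_append, Op]
    rw [ih (fun u => (hG u).cons z)]
    cases k z with
    | none => simp
    | some u => simp only [hG u l1 x y l2]

/-- supported on small vertices -/
def Su (n : ℕ) (F : List N2 → ℤ) : Prop := ∀ l, ∀ v ∈ vs l, n ≤ v → F l = 0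

theorem Op_su (k : N2 → Option ℕ) (n : ℕ)
    (hk : ∀ e x v, k e = some x → (v = e.1 ∨ v = e.2) → n ≤ v → n ≤ x)
    {G : ℕ → List N2 → ℤ} (hG : ∀ x, Su n (G x)) (hG' : ∀ x m, n ≤ x → G x m = 0) :
    Su n (fun l => Op k l G) := by
  intro l v hv hn
  simp only
  induction l generalizing G with
  | nil => rfl
  | cons e l ih =>
    have hcase : (v = e.1 ∨ v = e.2) ∨ v ∈ vs l := by
      simp only [vs, List.mem_cons] at hv; tauto
    rw [Op]
    rcases hcase with h | h
    · rw [Op_zero _ _ (fun x m => hG x (e :: m) v (by simp only [vs, List.mem_cons]; tauto) hn)]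
      cases hke : k e with
      | none => rfl
      | some x => simp [hG' x l (hk e x v hke h hn)]
    · rw [ih (fun x m u hu hnu => hG x (e :: m) u (by simp [vs, hu]) hnu) (fun x m hx => hG' x _ hx) h]
      cases hke : k e with
      | none => rfl
      | some x => simp [hG x l v h hn]

/-- kernel: other endpoint of the edge at `a` -/
def kx (a : ℕ) (e : N2) : Option ℕ := if e.1 = a then some e.2 else if e.2 = a then some e.1 else none

theorem kx_comm (a x y : ℕ) : kx a (x, y) = kx a (y, x) := by
  simp only [kx]; split_ifs <;> simp_all

theorem kx_su (a n : ℕ) (ha : a < n) (e : N2) (x v : ℕ) (h : kx a e = some x) (hv : v = e.1 ∨ v = e.2)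
    (hn : n ≤ v) : n ≤ x := by
  simp only [kx] at h; split_ifs at h <;> grind

theorem kx_none {a : ℕ} {l : List N2} (h : a ∉ vs l) : ∀ e ∈ l, kx a e = none := by
  intro e he
  have h1 : e.1 ≠ a := fun h' => h (mem_vs.2 ⟨e, he, Or.inl h'.symm⟩)
  have h2 : e.2 ≠ a := fun h' => h (mem_vs.2 ⟨e, he, Or.inr h'.symm⟩)
  simp [kx, h1, h2]

/-- suspension -/
def Sus (a : ℕ) (F : List N2 → ℤ) (l : List N2) : ℤ :=
  Op (kx a) l (fun x m => (if x < a then F m else 0) + Op (kx (a + 1)) m (fun y k => F ((x, y) :: k)))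
    - Op (kx (a + 1)) l (fun y m => if y < a then F m else 0)

def Rl (F : List N2 → ℤ) (p q t : ℕ) (r : List N2) : ℤ := F ((p, q) :: r) + F ((q, t) :: r) + F ((t, p) :: r)

structure Inv (a : ℕ) (F : List N2 → ℤ) : Prop where
  alt : Alt F
  sy : Sy F
  su : Su a F
  rel : ∀ p q t r, (p :: q :: t :: vs r).Perm (List.range a) → (3 : ℤ) ∣ Rl F p q t r

theorem Alt.add {α : Type*} {F G : List α → ℤ} (hF : Alt F) (hG : Alt G) : Alt (fun l => F l + G l) := by
  intro l1 x y l2; simp only [hF l1 x y l2, hG l1 x y l2]; ring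

theorem Alt.neg {α : Type*} {F : List α → ℤ} (hF : Alt F) : Alt (fun l => - F l) := by
  intro l1 x y l2; simp only [hF l1 x y l2]

theorem Alt.ite {α : Type*} {F : List α → ℤ} (hF : Alt F) (p : Prop) [Decidable p] :
    Alt (fun l => if p then F l else 0) := by
  intro l1 x y l2; simp only [hF l1 x y l2]; split_ifs <;> simp

theorem Alt.dvd_perm {α : Type*} {F : List α → ℤ} (hF : Alt F) {l l' : List α} (h : l.Perm l') (n : ℤ) :
    n ∣ F l ↔ n ∣ F l' := by
  induction h generalizing F with
  | nil => rfl
  | cons x _ ih => exact ih (hF.cons x)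
  | swap x y l => rw [hF.swap, dvd_neg]
  | trans _ _ ih1 ih2 => exact (ih1 hF).trans (ih2 hF)

theorem Sy.ite {F : List N2 → ℤ} (hF : Sy F) (p : Prop) [Decidable p] :
    Sy (fun l => if p then F l else 0) := by
  intro l1 x y l2; simp only [hF l1 x y l2]

theorem Sus_alt (a : ℕ) {F : List N2 → ℤ} (hF : Alt F) : Alt (Sus a F) := by
  have h1 := Op_alt (kx a) (G := fun x m => (if x < a then F m else 0)
    + Op (kx (a + 1)) m (fun y k => F ((x, y) :: k))) (fun x => Alt.add (hF.ite _)
      (Op_alt (kx (a + 1)) (G := fun y k => F ((x, y) :: k)) fun y => hF.cons _))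
  have h2 := Op_alt (kx (a + 1)) (G := fun y m => if y < a then F m else 0) (fun y => hF.ite _)
  intro l1 x y l2
  have e1 := h1 l1 x y l2
  have e2 := h2 l1 x y l2
  simp only at e1 e2
  rw [Sus, Sus, e1, e2]; ring

theorem Sus_sy (a : ℕ) {F : List N2 → ℤ} (hF : Sy F) : Sy (Sus a F) := by
  have h1 := Op_sy (kx a) (kx_comm a) (G := fun x m => (if x < a then F m else 0)
    + Op (kx (a + 1)) m (fun y k => F ((x, y) :: k))) (fun x => by
      intro l1 u v l2
      have e1 := hF.ite (x < a) l1 u v l2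
      have e2 := (Op_sy (kx (a + 1)) (kx_comm _) (G := fun y k => F ((x, y) :: k)) fun y => hF.cons _) l1 u v l2
      simp only at e1 e2 ⊢
      rw [e1, e2])
  have h2 := Op_sy (kx (a + 1)) (kx_comm _) (G := fun y m => if y < a then F m else 0) (fun y => hF.ite _)
  intro l1 x y l2
  have e1 := h1 l1 x y l2
  have e2 := h2 l1 x y l2
  simp only at e1 e2
  rw [Sus, Sus, e1, e2]

theorem Sus_su (a : ℕ) {F : List N2 → ℤ} (hF : Su a F) : Su (a + 2) (Sus a F) := by
  have hF' : Su (a + 2) F := fun l v hv hn => hF l v hv (by omega)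
  have h1 := Op_su (kx a) (a + 2) (kx_su a (a + 2) (by omega))
    (G := fun x m => (if x < a then F m else 0)
    + Op (kx (a + 1)) m (fun y k => F ((x, y) :: k))) (fun x => by
      intro l v hv hn
      have e2 := (Op_su (kx (a + 1)) (a + 2) (kx_su _ _ (by omega)) (G := fun y k => F ((x, y) :: k))
        (fun y m u hu hnu => hF' ((x, y) :: m) u (by simp [vs, hu]) hnu)
        (fun y m hy => hF' ((x, y) :: m) y (by simp [vs]) hy)) l v hv hn
      have e3 := hF' l v hv hn
      simp only [e3, ite_self, zero_add]
      exact e2) (fun x m hx => by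
        rw [Op_zero _ _ (fun y k => hF' ((x, y) :: k) x (by simp [vs]) hx), if_neg (by omega)]; rfl)
  have h2 := Op_su (kx (a + 1)) (a + 2) (kx_su _ _ (by omega)) (G := fun y m => if y < a then F m else 0)
    (fun y l v hv hn => by simp [hF' l v hv hn]) (fun y m hy => by rw [if_neg (by omega)])
  intro l v hv hn
  have e1 := h1 l v hv hn
  have e2 := h2 l v hv hn
  simp only at e1 e2
  rw [Sus, e1, e2]; rfl

theorem Sus0 (a : ℕ) (F : List N2 → ℤ) (m : List N2) (ha : a ∉ vs m) (hb : a + 1 ∉ vs m) :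
    Sus a F ((a, a + 1) :: m) = 0 := by
  rw [Sus, Op, Op, Op_none _ _ _ (kx_none ha), Op_none _ _ _ (kx_none hb)]
  simp [kx, Op_none _ _ _ (kx_none hb)]

theorem Sus1 (a : ℕ) (F : List N2 → ℤ) (m : List N2) (ha : a ∉ vs m) (hb : a + 1 ∉ vs m) (x : ℕ)
    (hx : x < a) : Sus a F ((a, x) :: m) = F m := by
  rw [Sus, Op, Op, Op_none _ _ _ (kx_none ha), Op_none _ _ _ (kx_none hb)]
  simp [kx, Op_none _ _ _ (kx_none hb), hx, (show x ≠ a + 1 by omega)]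

theorem Sus2 (a : ℕ) (F : List N2 → ℤ) (m : List N2) (ha : a ∉ vs m) (hb : a + 1 ∉ vs m) (x : ℕ)
    (hx : x < a) : Sus a F ((a + 1, x) :: m) = - F m := by
  rw [Sus, Op, Op, Op_none _ _ _ (kx_none ha), Op_none _ _ _ (kx_none hb)]
  simp [kx, hx, (show x ≠ a by omega)]

theorem Sus12 (a : ℕ) {F : List N2 → ℤ} (hF : Su a F) (m : List N2) (ha : a ∉ vs m) (hb : a + 1 ∉ vs m)
    (x y : ℕ) (hx : x < a) (hy : y < a) : Sus a F ((a, x) :: (a + 1, y) :: m) = F ((x, y) :: m) := by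
  have ka := kx_none ha
  have kb := kx_none hb
  simp only [Sus, Op, Op_none _ _ _ ka, Op_none _ _ _ kb]
  have h1 : F ((a + 1, y) :: m) = 0 := hF _ (a + 1) (by simp [vs]) (by omega)
  have h2 : F ((a, x) :: m) = 0 := hF _ a (by simp [vs]) (by omega)
  simp [kx, hx, hy, h1, h2, (show x ≠ a + 1 by omega), (show y ≠ a by omega)]

theorem Rl_alt {F : List N2 → ℤ} (hF : Alt F) (p q t : ℕ) : Alt (Rl F p q t) :=
  ((hF.cons (p, q)).add (hF.cons (q, t))).add (hF.cons (t, p))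

theorem Rl_sy {F : List N2 → ℤ} (hF : Sy F) (p q t : ℕ) (x y : ℕ) (l : List N2) :
    Rl F p q t ((x, y) :: l) = Rl F p q t ((y, x) :: l) := by
  simp only [Rl]
  have h : ∀ u v, F ((u, v) :: (x, y) :: l) = F ((u, v) :: (y, x) :: l) := fun u v => hF [(u, v)] x y l
  rw [h, h, h]

theorem Rl_cyc (F : List N2 → ℤ) (p q t : ℕ) (r : List N2) : Rl F p q t r = Rl F q t p r := by
  simp only [Rl]; ring

theorem Rl_swap {F : List N2 → ℤ} (hF : Sy F) (p q t : ℕ) (r : List N2) : Rl F p q t r = Rl F q p t r := by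
  simp only [Rl]; rw [hF.head p q, hF.head q t, hF.head t p]; ring

theorem exists_edge {v : ℕ} {r : List N2} (h : v ∈ vs r) :
    ∃ x r', r.Perm ((v, x) :: r') ∨ r.Perm ((x, v) :: r') := by
  obtain ⟨⟨a, b⟩, he, h1⟩ := mem_vs.1 h
  have hp := List.perm_cons_erase he
  rcases h1 with h1 | h1
  · simp only at h1; subst h1; exact ⟨_, _, Or.inl hp⟩
  · simp only at h1; subst h1; exact ⟨_, _, Or.inr hp⟩

/-- normalisation of one edge of `r` -/
theorem norm_edge {F : List N2 → ℤ} (ha : Alt F) (hs : Sy F) {p q t : ℕ} {v : ℕ} {r : List N2} (h : v ∈ vs r) :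
    ∃ x r', (vs r).Perm (v :: x :: vs r') ∧
      ((3 : ℤ) ∣ Rl F p q t r ↔ (3 : ℤ) ∣ Rl F p q t ((v, x) :: r')) := by
  obtain ⟨x, r', h1 | h1⟩ := exists_edge h
  · exact ⟨x, r', vs_perm h1, (Rl_alt ha p q t).dvd_perm h1 3⟩
  · refine ⟨x, r', (vs_perm h1).trans (List.Perm.swap _ _ _), ?_⟩
    rw [(Rl_alt ha p q t).dvd_perm h1 3, Rl_sy hs]

theorem perm_aux {a : ℕ} {L : List ℕ} (h : (a :: (a + 1) :: L).Perm (List.range (a + 2))) :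
    L.Perm (List.range a) ∧ a ∉ L ∧ a + 1 ∉ L ∧ ∀ v ∈ L, v < a := by
  have h1 : L.Perm (List.range a) := by
    rw [List.perm_iff_count] at h ⊢
    intro v
    have := h v
    rw [List.range_succ, List.range_succ] at this
    simp only [List.count_cons, List.count_append, List.count_nil] at this
    omega
  refine ⟨h1, ?_, ?_, ?_⟩
  · rw [h1.mem_iff]; simp
  · rw [h1.mem_iff]; simp
  · intro v hv; rw [h1.mem_iff] at hv; simpa using hv

theorem Sus_inv {a : ℕ} {F : List N2 → ℤ} (hF : Inv a F) : Inv (a + 2) (Sus a F) := by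
  have hA := Sus_alt a hF.alt
  have hS := Sus_sy a hF.sy
  refine ⟨hA, hS, Sus_su a hF.su, ?_⟩
  -- both free
  have case5 : ∀ p r, (a :: (a + 1) :: p :: vs r).Perm (List.range (a + 2)) →
      (3 : ℤ) ∣ Rl (Sus a F) p a (a + 1) r := by
    intro p r h
    obtain ⟨h1, h2, h3, h4⟩ := perm_aux h
    simp only [List.mem_cons, not_or] at h2 h3
    rw [Rl, hS.head p a, Sus1 a F r h2.2 h3.2 p (h4 p (by simp)), Sus0 a F r h2.2 h3.2,
      Sus2 a F r h2.2 h3.2 p (h4 p (by simp))]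
    simp
  -- a x in r, a + 1 free
  have case3 : ∀ p q x r, (a :: (a + 1) :: p :: q :: x :: vs r).Perm (List.range (a + 2)) →
      (3 : ℤ) ∣ Rl (Sus a F) p q (a + 1) ((a, x) :: r) := by
    intro p q x r h
    obtain ⟨h1, h2, h3, h4⟩ := perm_aux h
    have h5 := hF.rel p q x r h1
    simp only [List.mem_cons, not_or] at h2 h3
    have hx := h4 x (by simp)
    have hp := h4 p (by simp)
    have hq := h4 q (by simp)
    rw [Rl, hA.swap (p, q), Sus1 a F _ (by simp [vs]; tauto) (by simp [vs]; tauto) x hx,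
      hS.head q, hA.swap (a + 1, q), Sus12 a hF.su r h2.2.2.2 h3.2.2.2 x q hx hq,
      hA.swap (a + 1, p), Sus12 a hF.su r h2.2.2.2 h3.2.2.2 x p hx hp, hF.sy.head x q]
    rw [Rl] at h5
    have : -F ((p, q) :: r) + -F ((q, x) :: r) + -F ((x, p) :: r)
      = -(F ((p, q) :: r) + F ((q, x) :: r) + F ((x, p) :: r)) := by ring
    rw [this, dvd_neg]; exact h5
  -- a + 1 x in r, a free
  have case4 : ∀ p q x r, (a :: (a + 1) :: p :: q :: x :: vs r).Perm (List.range (a + 2)) →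
      (3 : ℤ) ∣ Rl (Sus a F) p q a ((a + 1, x) :: r) := by
    intro p q x r h
    obtain ⟨h1, h2, h3, h4⟩ := perm_aux h
    have h5 := hF.rel p q x r h1
    simp only [List.mem_cons, not_or] at h2 h3
    have hx := h4 x (by simp)
    have hp := h4 p (by simp)
    have hq := h4 q (by simp)
    rw [Rl, hA.swap (p, q), Sus2 a F _ (by simp [vs]; tauto) (by simp [vs]; tauto) x hx,
      hS.head q, Sus12 a hF.su r h2.2.2.2 h3.2.2.2 q x hq hx,
      Sus12 a hF.su r h2.2.2.2 h3.2.2.2 p x hp hx, hF.sy.head p x, neg_neg]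
    exact h5
  have case2 : ∀ p q t x y r, (a :: (a + 1) :: p :: q :: t :: x :: y :: vs r).Perm (List.range (a + 2)) →
      (3 : ℤ) ∣ Rl (Sus a F) p q t ((a, x) :: (a + 1, y) :: r) := by
    intro p q t x y r h
    obtain ⟨h1, h2, h3, h4⟩ := perm_aux h
    have h5 := hF.rel p q t ((x, y) :: r) h1
    simp only [List.mem_cons, not_or] at h2 h3
    have hx := h4 x (by simp)
    have hy := h4 y (by simp)
    have hone : ∀ u v, u ∈ [p, q, t] → v ∈ [p, q, t] →
        Sus a F ((u, v) :: (a, x) :: (a + 1, y) :: r) = - F ((u, v) :: (x, y) :: r) := by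
      intro u v hu hv
      rw [hA.swap, (hA.cons (a, x)).swap (u, v), neg_neg, Sus12 a hF.su _ _ _ x y hx hy, hF.alt.swap]
      · simp only [List.mem_cons, List.not_mem_nil, or_false] at hu hv
        simp only [vs, List.mem_cons, not_or]
        refine ⟨?_, ?_, by tauto⟩
        · rintro rfl; tauto
        · rintro rfl; tauto
      · simp only [List.mem_cons, List.not_mem_nil, or_false] at hu hv
        simp only [vs, List.mem_cons, not_or]
        refine ⟨?_, ?_, by tauto⟩
        · rintro rfl; tauto
        · rintro rfl; tauto
    rw [Rl, hone _ _ (by simp) (by simp), hone _ _ (by simp) (by simp), hone _ _ (by simp) (by simp)]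
    rw [Rl] at h5
    obtain ⟨k, hk⟩ := h5
    exact ⟨-k, by linarith⟩
  have case1 : ∀ p q t r, (a :: (a + 1) :: p :: q :: t :: vs r).Perm (List.range (a + 2)) →
      (3 : ℤ) ∣ Rl (Sus a F) p q t ((a, a + 1) :: r) := by
    intro p q t r h
    obtain ⟨h1, h2, h3, h4⟩ := perm_aux h
    simp only [List.mem_cons, not_or] at h2 h3
    rw [Rl, hA.swap, Sus0 a F _ (by simp [vs]; tauto) (by simp [vs]; tauto),
      hA.swap, Sus0 a F _ (by simp [vs]; tauto) (by simp [vs]; tauto),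
      hA.swap, Sus0 a F _ (by simp [vs]; tauto) (by simp [vs]; tauto)]
    simp
  have move : ∀ v p q t, v ∈ [p, q, t] → ∃ p' q', (∀ w, List.count w [p, q, t] = List.count w [p', q', v]) ∧
      ∀ r, Rl (Sus a F) p q t r = Rl (Sus a F) p' q' v r := by
    intro v p q t hv
    simp only [List.mem_cons, List.not_mem_nil, or_false] at hv
    rcases hv with rfl | rfl | rfl
    · exact ⟨q, t, fun w => by simp only [List.count_cons]; omega, fun r => Rl_cyc _ _ _ _ _⟩
    · exact ⟨t, p, fun w => by simp only [List.count_cons]; omega, fun r => by rw [Rl_cyc, Rl_cyc]⟩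
    · exact ⟨p, q, fun w => rfl, fun r => rfl⟩
  intro p q t r h
  have ha : a ∈ p :: q :: t :: vs r := by rw [h.mem_iff]; simp
  have hb : a + 1 ∈ p :: q :: t :: vs r := by rw [h.mem_iff]; simp
  have hsplit : ∀ (v : ℕ) (s : List N2), v ∈ p :: q :: t :: vs s → v ∈ [p, q, t] ∨ v ∈ vs s := by
    intro v s hv; simp only [List.mem_cons, List.not_mem_nil, or_false] at hv ⊢; tauto
  have hc := List.perm_iff_count.1 h
  rcases hsplit _ _ ha with ha' | ha'
  · obtain ⟨p', q', hm, hR⟩ := move a p q t ha'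
    rw [hR]
    rcases hsplit _ _ hb with hb' | hb'
    · have hb2 : a + 1 ∈ [p', q', a] := by
        rw [← List.count_pos_iff, ← hm, List.count_pos_iff]; exact hb'
      simp only [List.mem_cons, List.not_mem_nil, or_false] at hb2
      rcases hb2 with rfl | rfl | h3
      · rw [Rl_cyc]
        apply case5
        rw [List.perm_iff_count]
        intro w
        have e1 := hc w; have e2 := hm w
        simp only [List.count_cons, List.count_nil] at e1 e2 ⊢
        omega
      · rw [Rl_swap hS, ← Rl_cyc, Rl_cyc]
        rw [Rl_cyc]
        apply case5
        rw [List.perm_iff_count]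
        intro w
        have e1 := hc w; have e2 := hm w
        simp only [List.count_cons, List.count_nil] at e1 e2 ⊢
        omega
      · omega
    · obtain ⟨x, r', h1, h2⟩ := norm_edge hA hS (p := p') (q := q') (t := a) hb'
      rw [h2]
      apply case4
      rw [List.perm_iff_count] at h1 ⊢
      intro w
      have e1 := hc w; have e2 := hm w; have e3 := h1 w
      simp only [List.count_cons, List.count_nil] at e1 e2 e3 ⊢
      omega
  · obtain ⟨x, r', h1, h2⟩ := norm_edge hA hS (p := p) (q := q) (t := t) ha'
    rw [h2]
    rw [List.perm_iff_count] at h1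
    by_cases hx : x = a + 1
    · subst hx
      apply case1
      rw [List.perm_iff_count]
      intro w
      have e1 := hc w; have e3 := h1 w
      simp only [List.count_cons, List.count_nil] at e1 e3 ⊢
      omega
    have hb' : a + 1 ∈ p :: q :: t :: vs r' := by
      rw [← List.count_pos_iff] at hb ⊢
      have e3 := h1 (a + 1)
      simp only [List.count_cons, beq_iff_eq, hx, if_false, (show a ≠ a + 1 by omega)] at hb e3 ⊢
      omega
    rcases hsplit _ _ hb' with hb' | hb'
    · obtain ⟨p', q', hm, hR⟩ := move (a + 1) p q t hb'
      rw [hR]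
      apply case3
      rw [List.perm_iff_count]
      intro w
      have e1 := hc w; have e2 := hm w; have e3 := h1 w
      simp only [List.count_cons, List.count_nil] at e1 e2 e3 ⊢
      omega
    · obtain ⟨y, r'', h4 | h4⟩ := exists_edge hb'
      · rw [(Rl_alt hA p q t).dvd_perm (h4.cons (a, x))]
        apply case2
        have h5 := List.perm_iff_count.1 (vs_perm h4)
        rw [List.perm_iff_count]
        intro w
        have e1 := hc w; have e2 := h5 w; have e3 := h1 w
        simp only [vs, List.count_cons, List.count_nil] at e1 e2 e3 ⊢
        omega
      · rw [(Rl_alt hA p q t).dvd_perm ((h4.cons (a, x)).trans (List.Perm.swap _ _ _)), Rl_sy hS,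
          (Rl_alt hA p q t).dvd_perm (List.Perm.swap _ _ _)]
        apply case2
        have h5 := List.perm_iff_count.1 (vs_perm h4)
        rw [List.perm_iff_count]
        intro w
        have e1 := hc w; have e2 := h5 w; have e3 := h1 w
        simp only [vs, List.count_cons, List.count_nil] at e1 e2 e3 ⊢
        omega

end MM


namespace MM
open MatchPaper

def nm (e : N2) : N2 := if e.1 ≤ e.2 then e else (e.2, e.1)

def ky (t e : N2) : Option ℕ := if nm e = t then some 0 else none

def Yt (t : N2) (G : List N2 → ℤ) (l : List N2) : ℤ := Op (ky t) l (fun _ m => G m)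

def dnil (l : List N2) : ℤ := if l = [] then 1 else 0

/-- the basic cochain on seven points -/
def tab : List (N2 × N2 × N2 × ℤ) := [
  ((0, 3), (1, 4), (2, 5), -1),
  ((0, 3), (1, 4), (2, 6), 1),
  ((0, 3), (1, 5), (2, 6), -1),
  ((0, 3), (1, 5), (4, 6), 1),
  ((0, 3), (2, 5), (4, 6), -1),
  ((0, 4), (1, 3), (2, 5), -1),
  ((0, 4), (1, 3), (2, 6), 1),
  ((0, 4), (1, 5), (2, 3), 1),
  ((0, 4), (1, 5), (2, 6), -1),
  ((0, 4), (1, 6), (2, 3), -1),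
  ((0, 4), (1, 6), (2, 5), 1),
  ((0, 5), (1, 3), (2, 6), -1),
  ((0, 5), (1, 3), (4, 6), 1),
  ((0, 5), (1, 4), (2, 3), 1),
  ((0, 5), (1, 4), (2, 6), -1),
  ((0, 5), (1, 6), (2, 3), 1),
  ((0, 5), (1, 6), (3, 4), -1),
  ((0, 5), (2, 3), (4, 6), -1),
  ((0, 5), (2, 6), (3, 4), 1),
  ((0, 6), (1, 4), (2, 3), -1),
  ((0, 6), (1, 4), (2, 5), 1),
  ((0, 6), (1, 5), (2, 3), 1),
  ((0, 6), (1, 5), (3, 4), -1),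
  ((0, 6), (2, 5), (3, 4), 1),
  ((1, 3), (2, 5), (4, 6), 1),
  ((1, 5), (2, 3), (4, 6), 1),
  ((1, 5), (2, 6), (3, 4), -1),
  ((1, 6), (2, 5), (3, 4), -1)]

def F0 (l : List N2) : ℤ := (tab.map fun t => t.2.2.2 * Yt t.1 (Yt t.2.1 (Yt t.2.2.1 dnil)) l).sum

theorem nm_comm (x y : ℕ) : nm (x, y) = nm (y, x) := by
  simp only [nm]; split_ifs with h1 h2 h2 <;> simp <;> omega

theorem dnil_alt : Alt dnil := by intro l1 x y l2; simp [dnil]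
theorem dnil_sy : Sy dnil := by intro l1 x y l2; simp [dnil]
theorem dnil_su : Su 7 dnil := by
  intro l v hv _
  cases l with
  | nil => simp [vs] at hv
  | cons e l => simp [dnil]

structure Pre (F : List N2 → ℤ) : Prop where
  alt : Alt F
  sy : Sy F
  su : Su 7 F

theorem dnil_pre : Pre dnil := ⟨dnil_alt, dnil_sy, dnil_su⟩

theorem Yt_pre {F : List N2 → ℤ} (h : Pre F) (t : N2) (ht : t.1 < 7 ∧ t.2 < 7) : Pre (Yt t F) := by
  refine ⟨Op_alt _ fun _ => h.alt, Op_sy _ (fun x y => by simp only [ky, nm_comm x y]) fun _ => h.sy, ?_⟩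
  intro l v hv hn
  unfold Yt
  induction l generalizing F with
  | nil => rfl
  | cons e l ih =>
    have hsub : Pre (fun m => F (e :: m)) := ⟨h.alt.cons e, h.sy.cons e, fun m u hu hnu =>
      h.su (e :: m) u (by simp [vs, hu]) hnu⟩
    have hcase : (v = e.1 ∨ v = e.2) ∨ v ∈ vs l := by
      simp only [vs, List.mem_cons] at hv; tauto
    rw [Op]
    rcases hcase with hc | hc
    · rw [Op_zero _ _ (fun x m => h.su (e :: m) v (by simp only [vs, List.mem_cons]; tauto) hn)]
      have : ky t e = none := by
        rw [ky, if_neg]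
        rintro rfl
        simp only [nm] at ht
        split_ifs at ht <;> rcases hc with rfl | rfl <;> (try simp only at ht) <;> omega
      rw [this]; rfl
    · rw [ih hsub hc]
      cases ky t e with
      | none => rfl
      | some x => simp [h.su l v hc hn]

theorem sum_pre {ι : Type} (L : List ι) (c : ι → ℤ) (G : ι → List N2 → ℤ) (h : ∀ i ∈ L, Pre (G i)) :
    Pre (fun l => (L.map fun i => c i * G i l).sum) := by
  induction L with
  | nil =>
    refine ⟨?_, ?_, ?_⟩
    · intro l1 x y l2; simp
    · intro l1 x y l2; simp
    · intro l v _ _; simp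
  | cons i L ih =>
    have h1 := ih fun j hj => h j (by simp [hj])
    have h2 := h i (by simp)
    refine ⟨?_, ?_, ?_⟩
    · intro l1 x y l2
      have e1 := h1.alt l1 x y l2
      have e2 := h2.alt l1 x y l2
      simp only [List.map_cons, List.sum_cons] at e1 ⊢
      rw [e1, e2]; ring
    · intro l1 x y l2
      have e1 := h1.sy l1 x y l2
      have e2 := h2.sy l1 x y l2
      simp only [List.map_cons, List.sum_cons] at e1 ⊢
      rw [e1, e2]
    · intro l v hv hn
      have e1 := h1.su l v hv hn
      have e2 := h2.su l v hv hn
      simp only [List.map_cons, List.sum_cons] at e1 ⊢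
      rw [e1, e2]; simp

theorem F0_pre : Pre F0 := by
  have ht : ∀ t ∈ tab, (t.1.1 < 7 ∧ t.1.2 < 7) ∧ (t.2.1.1 < 7 ∧ t.2.1.2 < 7) ∧
    (t.2.2.1.1 < 7 ∧ t.2.2.1.2 < 7) := by decide
  exact sum_pre tab (fun t => t.2.2.2) (fun t => Yt t.1 (Yt t.2.1 (Yt t.2.2.1 dnil))) fun t h =>
    Yt_pre (Yt_pre (Yt_pre dnil_pre _ (ht t h).2.2) _ (ht t h).2.1) _ (ht t h).1

set_option maxRecDepth 10000 in
theorem F0_check : ∀ p ∈ List.range 7, ∀ q ∈ List.range 7, p < q → ∀ t ∈ List.range 7, q < t →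
    ∀ a ∈ List.range 7, a ∉ [p, q, t] → ∀ b ∈ List.range 7, a < b → b ∉ [p, q, t] →
    ∀ c ∈ List.range 7, a < c → c ∉ [p, q, t, b] → ∀ d ∈ List.range 7, c < d → d ∉ [p, q, t, b] →
    (3 : ℤ) ∣ Rl F0 p q t [(a, b), (c, d)] := by
  decide +kernel

theorem wlog3 (P : ℕ → ℕ → ℕ → Prop) (hs : ∀ p q t, P p q t → P q p t) (hc : ∀ p q t, P p q t → P q t p)
    (h : ∀ p q t, p < q → q < t → P p q t) (p q t : ℕ) (h1 : p ≠ q) (h2 : q ≠ t) (h3 : p ≠ t) : P p q t := by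
  rcases lt_or_gt_of_ne h1 with h1 | h1 <;> rcases lt_or_gt_of_ne h2 with h2 | h2 <;>
    rcases lt_or_gt_of_ne h3 with h3 | h3
  · exact h _ _ _ h1 h2
  · omega
  · exact hs _ _ _ (hc _ _ _ (hc _ _ _ (h _ _ _ h3 h2)))
  · exact hc _ _ _ (h _ _ _ h3 h1)
  · exact hs _ _ _ (h _ _ _ h1 h3)
  · exact hc _ _ _ (hc _ _ _ (h _ _ _ h2 h3))
  · omega
  · exact hs _ _ _ (hc _ _ _ (h _ _ _ h2 h1))

theorem F0_inv : Inv 7 F0 := by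
  have hA := F0_pre.alt
  have hS := F0_pre.sy
  refine ⟨hA, hS, F0_pre.su, ?_⟩
  intro p q t r h
  have hlen : r.length = 2 := by
    have := h.length_eq
    simp [vs_length] at this; omega
  match r, hlen with
  | [(a, b), (c, d)], _ =>
  simp only [vs] at h
  have hn : [p, q, t, a, b, c, d].Nodup := h.nodup_iff.2 (List.nodup_range)
  have hlt : ∀ v ∈ [p, q, t, a, b, c, d], v ∈ List.range 7 := fun v hv => h.mem_iff.1 hv
  clear h
  revert a b c d
  -- first the order of p q t
  have main : ∀ a b c d, [p, q, t, a, b, c, d].Nodup → (∀ v ∈ [p, q, t, a, b, c, d], v ∈ List.range 7) →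
      a < b → c < d → a < c → (3 : ℤ) ∣ Rl F0 p q t [(a, b), (c, d)] := by
    intro a b c d hn hlt hab hcd hac
    have hpq : p ≠ q ∧ q ≠ t ∧ p ≠ t := by simp at hn; tauto
    refine wlog3 (fun p q t => [p, q, t, a, b, c, d].Nodup → (∀ v ∈ [p, q, t, a, b, c, d], v ∈ List.range 7) →
      (3 : ℤ) ∣ Rl F0 p q t [(a, b), (c, d)]) ?_ ?_ ?_ p q t hpq.1 hpq.2.1 hpq.2.2 hn hlt
    · intro p q t h hn hlt
      rw [Rl_swap hS]
      exact h ((List.Perm.swap _ _ _).nodup_iff.1 hn) (fun v hv => hlt v ((List.Perm.swap _ _ _).mem_iff.1 hv))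
    · intro p q t h hn hlt
      rw [← Rl_cyc]
      have hp : [p, q, t, a, b, c, d].Perm [q, t, p, a, b, c, d] :=
        (List.Perm.swap _ _ _).trans ((List.Perm.swap _ _ _).cons _)
      exact h (hp.nodup_iff.2 hn) (fun v hv => hlt v (hp.mem_iff.1 hv))
    · intro p q t hpq hqt hn hlt
      simp only [List.nodup_cons, List.mem_cons, List.not_mem_nil, or_false, not_or] at hn
      refine F0_check p (hlt _ (by simp)) q (hlt _ (by simp)) hpq t (hlt _ (by simp)) hqt
        a (hlt _ (by simp)) ?_ b (hlt _ (by simp)) hab ?_ c (hlt _ (by simp)) hac ?_ d (hlt _ (by simp)) hcd ?_ <;>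
      · simp only [List.mem_cons, List.not_mem_nil, or_false, not_or]
        grind
  have m2 : ∀ a b c d, [p, q, t, a, b, c, d].Nodup → (∀ v ∈ [p, q, t, a, b, c, d], v ∈ List.range 7) →
      a < b → c < d → (3 : ℤ) ∣ Rl F0 p q t [(a, b), (c, d)] := by
    intro a b c d hn hlt hab hcd
    rcases lt_trichotomy a c with h | h | h
    · exact main a b c d hn hlt hab hcd h
    · simp at hn; omega
    · rw [(Rl_alt hA p q t).dvd_perm (List.Perm.swap _ _ _)]
      refine main c d a b ?_ ?_ hcd hab h
      · grind
      · intro v hv; apply hlt; simp at hv ⊢; tauto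
  have m3 : ∀ a b c d, [p, q, t, a, b, c, d].Nodup → (∀ v ∈ [p, q, t, a, b, c, d], v ∈ List.range 7) →
      a < b → (3 : ℤ) ∣ Rl F0 p q t [(a, b), (c, d)] := by
    intro a b c d hn hlt hab
    rcases lt_trichotomy c d with h | h | h
    · exact m2 a b c d hn hlt hab h
    · simp at hn; omega
    · rw [(Rl_alt hA p q t).dvd_perm (List.Perm.swap _ _ _), Rl_sy hS,
        (Rl_alt hA p q t).dvd_perm (List.Perm.swap _ _ _)]
      refine m2 a b d c ?_ ?_ hab h
      · grind
      · intro v hv; apply hlt; simp at hv ⊢; tauto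
  intro a b c d _ hn hlt
  rcases lt_trichotomy a b with h | h | h
  · exact m3 a b c d hn hlt h
  · simp at hn; omega
  · rw [Rl_sy hS]
    refine m3 b a c d ?_ ?_ h
    · grind
    · intro v hv; apply hlt; simp at hv ⊢; tauto

def W : List N2 → ℤ := Sus 11 (Sus 9 (Sus 7 F0))

theorem W_inv : Inv 13 W := Sus_inv (Sus_inv (Sus_inv F0_inv))

end MM


namespace MM
open MatchPaper

theorem mu_ed (a b : V) : mu (ed a b) = fun x => ind a x + ind b x := by
  funext x
  simp only [mu, ed]
  rcases le_total a b with h | h <;> simp [h]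
  ring

theorem van_alg (F : List E → ℤ) (hF : Alt F) (a b c d e f : V) (r : List (E → ℤ)) :
    Sm (mu (ed a d) :: mu (ed b f) :: mu (ed c e) :: r) F
      - Sm (mu (ed a e) :: mu (ed b d) :: mu (ed c f) :: r) F
      - Sm (mu (ed a f) :: mu (ed b c) :: mu (ed d e) :: r) F
      + Sm (mu (ed a b) :: mu (ed c d) :: mu (ed e f) :: r) F
      + Sm (mu (ed a c) :: mu (ed b e) :: mu (ed d f) :: r) F = 0 := by
  have hA := Sm_alt hF
  obtain ⟨T, hT⟩ : ∃ T : V → V → V → ℤ, T = fun x y z => Sm (ind x :: ind y :: ind z :: r) F := ⟨_, rfl⟩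
  have h2 : ∀ (h h' g : E → ℤ) (hs : List (E → ℤ)), Sm (g :: (fun x => h x + h' x) :: hs) F
      = Sm (g :: h :: hs) F + Sm (g :: h' :: hs) F := by
    intro h h' g hs; rw [Sm_cons', Sm_head_add, Sm_cons' g, Sm_cons' g]
  have h3 : ∀ (h h' g k : E → ℤ) (hs : List (E → ℤ)), Sm (k :: g :: (fun x => h x + h' x) :: hs) F
      = Sm (k :: g :: h :: hs) F + Sm (k :: g :: h' :: hs) F := by
    intro h h' g k hs
    simp only [Sm_cons' k, Sm_cons' g, Sm_head_add]
  have ex : ∀ x x' y y' z z', Sm (mu (ed x x') :: mu (ed y y') :: mu (ed z z') :: r) F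
      = T x y z + T x y z' + T x y' z + T x y' z' + T x' y z + T x' y z' + T x' y' z + T x' y' z' := by
    intro x x' y y' z z'
    rw [mu_ed, mu_ed, mu_ed]
    simp only [Sm_head_add, h2, h3, hT]; ring
  have t213 : ∀ x y z, T y x z = - T x y z := by
    intro x y z; rw [hT]; exact hA [] (ind y) (ind x) (ind z :: r)
  have t132 : ∀ x y z, T x z y = - T x y z := by
    intro x y z; rw [hT]; exact hA [ind x] (ind z) (ind y) r
  have t231 : ∀ x y z, T y z x = T x y z := by
    intro x y z; rw [t132 y x z, t213]; ring
  have t312 : ∀ x y z, T z x y = T x y z := by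
    intro x y z; rw [t213 x z y, t132]; ring
  have t321 : ∀ x y z, T z y x = - T x y z := by
    intro x y z; rw [t213 y z x, t231]
  simp only [ex]
  linear_combination (1) * t132 a c f + (1) * t132 a e f + (1) * t312 b c d + (1) * t213 b d e + (1) * t231 c d f +
    (1) * t132 d e f + (-1) * t132 a c d + (-1) * t312 b c e + (-1) * t213 b e f + (-1) * t321 c d
    e + (-1) * t213 d e f + (-1) * t312 b d f + (-1) * t312 b e f + (-1) * t312 c d f + (-1) * t312
    c e f + (1) * t132 a d e + (1) * t213 b c d + (1) * t213 b c f + (1) * t132 c d e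

/-- the five term combination -/
def tv (F : List E → ℤ) (a b c d e f : V) (r : List E) : ℤ :=
  F (ed a d :: ed b f :: ed c e :: r) - F (ed a e :: ed b d :: ed c f :: r)
    - F (ed a f :: ed b c :: ed d e :: r) + F (ed a b :: ed c d :: ed e f :: r)
    + F (ed a c :: ed b e :: ed d f :: r)

def MtAll (a b c d e f : V) (r : List E) : Prop :=
  Mt (ed a d :: ed b f :: ed c e :: r) ∧ Mt (ed a e :: ed b d :: ed c f :: r) ∧
    Mt (ed a f :: ed b c :: ed d e :: r) ∧ Mt (ed a b :: ed c d :: ed e f :: r) ∧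
    Mt (ed a c :: ed b e :: ed d f :: r)

theorem van {F : List E → ℤ} (hF : Good Finset.univ 6 F) (hb : ∀ l, bd F l = 0) (a b c d e f : V)
    (r : List E) (hr : r.length = 3) (hM : MtAll a b c d e f r) : tv F a b c d e f r = 0 := by
  have key : ∀ x y z, Mt (x :: y :: z :: r) → Sm (mu x :: mu y :: mu z :: r.map mu) F
      = 720 * F (x :: y :: z :: r) := by
    intro x y z h
    have := main_b 6 Finset.univ F (by simp [V]) hF hb (x :: y :: z :: r) h (by simp [hr]) (by simp)
    rw [show (Nat.factorial 6 : ℤ) = 720 by decide] at this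
    exact this
  obtain ⟨h1, h2, h3, h4, h5⟩ := hM
  have := van_alg F hF.alt a b c d e f (r.map mu)
  rw [key _ _ _ h1, key _ _ _ h2, key _ _ _ h3, key _ _ _ h4, key _ _ _ h5] at this
  rw [tv]; linarith

/-- the ten subsets, with complements -/
def dat : Fin 10 → V × V × V × V × V := ![
  (0, 1, 2, 3, 4),
  (0, 1, 3, 2, 4),
  (0, 1, 4, 2, 3),
  (0, 2, 3, 1, 4),
  (0, 2, 4, 1, 3),
  (0, 3, 4, 1, 2),
  (1, 2, 3, 0, 4),
  (1, 2, 4, 0, 3),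
  (1, 3, 4, 0, 2),
  (2, 3, 4, 0, 1)]

def ord (k : Fin 10) : List V :=
  [8, 9, 10, 11, 12, (dat k).2.2.2.1, (dat k).2.2.2.2, (dat k).1, 5, (dat k).2.1, 6, (dat k).2.2.1, 7]

def pin (k : Fin 10) (v : V) : ℕ := (ord k).idxOf v

def pe (k : Fin 10) (x : E) : N2 := (pin k x.1, pin k x.2)

def w (k : Fin 10) (l : List E) : ℤ := W (l.map (pe k))

def rr (k : Fin 10) : List E := [((dat k).1, 8), ((dat k).2.1, 9), ((dat k).2.2.1, 10)]

def tk (F : List E → ℤ) (k : Fin 10) : ℤ := tv F 5 6 7 11 (dat k).2.2.2.1 (dat k).2.2.2.2 (rr k)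

instance (l : List E) : Decidable (Mt l) := by unfold Mt; infer_instance

theorem mtall (k : Fin 10) : MtAll 5 6 7 11 (dat k).2.2.2.1 (dat k).2.2.2.2 (rr k) := by
  revert k
  unfold MtAll
  decide +kernel

theorem pin_perm (k : Fin 10) : ((List.finRange 13).map (pin k)).Perm (List.range 13) := by
  revert k
  decide +kernel

/-- guarded version, for faster evaluation -/
def gd (a : ℕ) (F : List N2 → ℤ) (l : List N2) : ℤ := if (vs l).all (fun v => decide (v < a)) then F l else 0

theorem gd_eq {a : ℕ} {F : List N2 → ℤ} (h : Su a F) : gd a F = F := by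
  funext l
  rw [gd]
  split_ifs with hc
  · rfl
  · simp only [List.all_eq_true, decide_eq_true_eq, not_forall] at hc
    obtain ⟨v, hv, hn⟩ := hc
    exact (h l v hv (by omega)).symm

def W2 : List N2 → ℤ := Sus 11 (gd 11 (Sus 9 (gd 9 (Sus 7 (gd 7 F0)))))

theorem W2_eq : W2 = W := by
  rw [W2, gd_eq F0_inv.su, gd_eq (Sus_inv F0_inv).su, gd_eq (Sus_inv (Sus_inv F0_inv)).su, W]

def frc (n : ℕ) (f : ℕ → ℤ) : ℤ := match n with
  | 0 => f 0
  | n + 1 => f (n + 1)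

theorem frc_eq (n : ℕ) (f : ℕ → ℤ) : frc n f = f n := by cases n <;> rfl

/-- evaluate after forcing the vertex labels -/
def evl (g : V → ℕ) : List E → (List N2 → ℤ) → ℤ
  | [], F => F []
  | e :: l, F => frc (g e.1) fun x => frc (g e.2) fun y => evl g l fun m => F ((x, y) :: m)

theorem evl_eq (g : V → ℕ) (l : List E) (F : List N2 → ℤ) :
    evl g l F = F (l.map fun e => (g e.1, g e.2)) := by
  induction l generalizing F with
  | nil => rfl
  | cons e l ih => simp only [evl, frc_eq, ih, List.map_cons]

theorem w_eq (k : Fin 10) (l : List E) : w k l = evl (pin k) l W2 := by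
  rw [evl_eq, W2_eq]; rfl

theorem w_tk' : ∀ k m : Fin 10, (tk (fun l => evl (pin k) l W2) m - if k = m then 1 else 0) % 3 = 0 := by
  decide +kernel

theorem w_tk (k m : Fin 10) : (tk (w k) m - if k = m then 1 else 0) % 3 = 0 := by
  have : w k = fun l => evl (pin k) l W2 := funext fun l => w_eq k l
  rw [this]; exact w_tk' k m

end MM


namespace MM
open MatchPaper

/-- the integral lift of the cocycle -/
def Phi (k : Fin 10) (l : List E) : ℤ := if Mt l ∧ l.length = 6 then w k l else 0

theorem Phi_good (k : Fin 10) : Good Finset.univ 6 (Phi k) := by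
  refine ⟨?_, ?_⟩
  · intro l1 x y l2
    have hp : (l1 ++ x :: y :: l2).Perm (l1 ++ y :: x :: l2) := (List.Perm.swap _ _ _).append_left _
    have h1 : Mt (l1 ++ x :: y :: l2) ↔ Mt (l1 ++ y :: x :: l2) := ⟨fun h => h.perm hp, fun h => h.perm hp.symm⟩
    have h2 := W_inv.alt (l1.map (pe k)) (pe k x) (pe k y) (l2.map (pe k))
    simp only [Phi, h1, hp.length_eq, w, List.map_append, List.map_cons, h2]
    split_ifs <;> simp
  · intro l h
    rw [Phi] at h
    split_ifs at h with hc
    · exact ⟨hc.1, hc.2, by simp⟩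
    · exact absurd rfl h

theorem vs_map (k : Fin 10) (l : List E) : vs (l.map (pe k)) = (vs l).map (pin k) := by
  induction l with
  | nil => rfl
  | cons e l ih => simp [vs, ih, pe]

theorem W_ed (k : Fin 10) (a b : V) (l : List E) :
    w k (ed a b :: l) = W ((pin k a, pin k b) :: l.map (pe k)) := by
  rw [w, List.map_cons, pe, ed]
  rcases le_total a b with h | h
  · simp only [min_eq_left h, max_eq_right h]
  · simp only [min_eq_right h, max_eq_left h]; exact W_inv.sy.head _ _ _

theorem Mt_ed {a b : V} {l : List E} (h : Mt l) (hab : a ≠ b) (ha : a ∉ vs l) (hb : b ∉ vs l) :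
    Mt (ed a b :: l) := by
  rw [Mt.cons_iff, ed]
  rcases lt_or_gt_of_ne hab with h1 | h1
  · simp only [min_eq_left h1.le, max_eq_right h1.le]; exact ⟨h1, ha, hb, h⟩
  · simp only [min_eq_right h1.le, max_eq_left h1.le]; exact ⟨h1, hb, ha, h⟩

theorem bd_supp {F : List E → ℤ} {c : ℕ} (hF : Good Finset.univ (c + 1) F) {l : List E} (h : bd F l ≠ 0) :
    Mt l ∧ l.length = c := by
  obtain ⟨x, _, hx⟩ := Finset.exists_ne_zero_of_sum_ne_zero h
  obtain ⟨h1, h2, _⟩ := hF.supp _ hx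
  exact ⟨h1.tail, by simpa using h2⟩

theorem dvd_bd (k : Fin 10) (l : List E) : (3 : ℤ) ∣ bd (Phi k) l := by
  by_cases h : bd (Phi k) l = 0
  · rw [h]; exact dvd_zero _
  obtain ⟨h1, h2⟩ := bd_supp (Phi_good k) h
  have hc : (free Finset.univ l).card = 3 := by
    have := free_card (S := Finset.univ) l h1 (by simp)
    simp [V] at this; omega
  obtain ⟨a, b, c, hab, hac, hbc, he⟩ := Finset.card_eq_three.1 hc
  have hfree : ∀ v, v ∉ vs l ↔ v = a ∨ v = b ∨ v = c := by
    intro v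
    have : v ∈ free Finset.univ l ↔ v ∈ ({a, b, c} : Finset V) := by rw [he]
    simpa [free] using this
  have ha := (hfree a).2 (by simp)
  have hb := (hfree b).2 (by simp)
  have hc' := (hfree c).2 (by simp)
  have e1 : ∀ x y, x ≠ y → x ∉ vs l → y ∉ vs l → Phi k (ed x y :: l)
      = W ((pin k x, pin k y) :: l.map (pe k)) := by
    intro x y hxy hx hy
    rw [Phi, if_pos ⟨Mt_ed h1 hxy hx hy, by simp [h2]⟩, W_ed]
  rw [bd_three (S := Finset.univ) (k := 6) (by simp [V]) (Phi_good k) l hab hac hbc (by simp) (by simp) (by simp)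
    ha hb hc', e1 a b hab ha hb, e1 b c hbc hb hc', e1 a c hac ha hc', W_inv.sy.head (pin k a) (pin k c)]
  apply W_inv.rel
  rw [vs_map]
  refine List.Perm.trans ?_ (pin_perm k)
  have : (a :: b :: c :: vs l).Perm (List.finRange 13) := by
    rw [List.perm_ext_iff_of_nodup]
    · intro v
      have := hfree v
      simp only [List.mem_cons, List.mem_finRange, iff_true]
      tauto
    · simp only [List.nodup_cons, List.mem_cons, not_or]
      exact ⟨⟨hab, hac, ha⟩, ⟨hbc, hb⟩, hc', h1.2⟩
    · exact List.nodup_finRange 13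
  exact this.map (pin k)

def zf (k : Fin 10) (l : List E) : ℤ := bd (Phi k) l / 3

theorem three_zf (k : Fin 10) (l : List E) : 3 * zf k l = bd (Phi k) l := Int.mul_ediv_cancel' (dvd_bd k l)

theorem zf_good (k : Fin 10) : Good Finset.univ 5 (zf k) := by
  refine ⟨?_, ?_⟩
  · intro l1 x y l2
    have h := bd_alt (Phi_good k).alt l1 x y l2
    rw [← three_zf, ← three_zf] at h
    linarith
  · intro l h
    have h3 : bd (Phi k) l ≠ 0 := by
      intro h0; apply h; rw [zf, h0]; rfl
    obtain ⟨h1, h2⟩ := bd_supp (Phi_good k) h3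
    exact ⟨h1, h2, by simp⟩

noncomputable def zc (k : Fin 10) : C 5 := ofFun 5 (zf k)
noncomputable def fc (k : Fin 10) : C 6 := ofFun 6 (Phi k)

theorem three_zc (k : Fin 10) : (3 : ℤ) • zc k = D 5 (fc k) := by
  apply hat_inj
  intro l
  have h : hat (fc k) = Phi k := funext fun m => hat_ofFun (Phi_good k) m
  rw [hat_smul, hat_bdry, h, zc, hat_ofFun (zf_good k), three_zf]

theorem zc_cyc (k : Fin 10) : zc k ∈ cycLow ℤ rk K 5 := by
  rw [mem_cyc]
  intro l
  have h : hat (zc k) = zf k := funext fun m => hat_ofFun (zf_good k) m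
  rw [h]
  have h2 := bd_bd (Phi_good k).alt l
  have h3 : bd (bd (Phi k)) l = 3 * bd (zf k) l := by
    simp only [bd, Finset.mul_sum]
    exact Finset.sum_congr rfl fun x _ => (three_zf k (x :: l)).symm
  omega

theorem tk_Phi (k m : Fin 10) : tk (Phi k) m = tk (w k) m := by
  obtain ⟨h1, h2, h3, h4, h5⟩ := mtall m
  simp only [tk, tv, Phi]
  rw [if_pos ⟨h1, rfl⟩, if_pos ⟨h2, rfl⟩, if_pos ⟨h3, rfl⟩, if_pos ⟨h4, rfl⟩, if_pos ⟨h5, rfl⟩]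

theorem indep (c : Fin 10 → ℤ) (h : ∑ k, c k • zc k ∈ LinearMap.range (D 5)) (m : Fin 10) : (3 : ℤ) ∣ c m := by
  obtain ⟨y, hy⟩ := h
  have h0 : D 5 (∑ k, c k • fc k - (3 : ℤ) • y) = 0 := by
    rw [map_sub, map_smul, hy, map_sum, Finset.smul_sum, sub_eq_zero]
    refine Finset.sum_congr rfl fun k _ => ?_
    rw [map_smul, ← three_zc, smul_comm]
  have h1 := van (hat_good _) ((D_zero_iff _).1 h0) 5 6 7 11 (dat m).2.2.2.1 (dat m).2.2.2.2 (rr m) rfl (mtall m)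
  have h2 : tk (hat (∑ k, c k • fc k - (3 : ℤ) • y)) m = ∑ k, c k * tk (w k) m - 3 * tk (hat y) m := by
    have hl : ∀ l, hat (∑ k, c k • fc k - (3 : ℤ) • y) l = ∑ k, c k * Phi k l - 3 * hat y l := by
      intro l
      rw [hat_sub, hat_sum, hat_smul]
      congr 1
      refine Finset.sum_congr rfl fun k _ => ?_
      rw [hat_smul, fc, hat_ofFun (Phi_good k)]
    simp only [← tk_Phi]
    simp only [tk, tv, hl, mul_add, mul_sub, Finset.sum_add_distrib, Finset.sum_sub_distrib]
    ring
  have h3 : ∑ k, c k * tk (w k) m = 3 * tk (hat y) m := by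
    have : tk (hat (∑ k, c k • fc k - (3 : ℤ) • y)) m = 0 := h1
    linarith
  have h4 : ∀ k, ∃ u : ℤ, tk (w k) m = (if k = m then 1 else 0) + 3 * u := by
    intro k
    obtain ⟨u, hu⟩ := Int.dvd_of_emod_eq_zero (w_tk k m)
    exact ⟨u, by linarith⟩
  choose u hu using h4
  simp only [hu, mul_add, Finset.sum_add_distrib, mul_ite, mul_one, mul_zero, Finset.sum_ite_eq',
    Finset.mem_univ, if_true] at h3
  have h5 : ∑ k, c k * (3 * u k) = 3 * ∑ k, c k * u k := by
    rw [Finset.mul_sum]; exact Finset.sum_congr rfl fun k _ => by ring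
  rw [h5] at h3
  exact ⟨tk (hat y) m - ∑ k, c k * u k, by linarith⟩

/-- homology classes -/
noncomputable def cl (k : Fin 10) : MH ℤ 13 4 := Submodule.Quotient.mk ⟨zc k, zc_cyc k⟩

theorem cl_sum (c : Fin 10 → ℤ) (h : ∑ k, c k • cl k = 0) : ∑ k, c k • zc k ∈ LinearMap.range (D 5) := by
  have h1 : ∑ k, c k • cl k = Submodule.Quotient.mk (∑ k, c k • (⟨zc k, zc_cyc k⟩ : cycLow ℤ rk K 5)) := by
    simp only [cl, ← Submodule.mkQ_apply, map_sum, map_smul]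
  rw [h1, Submodule.Quotient.mk_eq_zero] at h
  simpa using h

theorem three_cl (k : Fin 10) : (3 : ℤ) • cl k = 0 := by
  rw [cl, ← Submodule.Quotient.mk_smul, Submodule.Quotient.mk_eq_zero]
  exact ⟨fc k, (three_zc k).symm⟩

noncomputable def hh : (Fin 10 → ZMod 3) →+ MH ℤ 13 4 :=
  ∑ k : Fin 10, (ZMod.lift 3 ⟨(zmultiplesHom _ (cl k)), by
    simp only [zmultiplesHom_apply]; exact three_cl k⟩).comp (Pi.evalAddMonoidHom (fun _ => ZMod 3) k)

theorem hh_inj : Function.Injective hh := by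
  rw [injective_iff_map_eq_zero]
  intro x hx
  have h1 : ∑ k, ((x k).val : ℤ) • cl k = 0 := by
    rw [← hx, hh, AddMonoidHom.finsetSum_apply]
    refine Finset.sum_congr rfl fun k _ => ?_
    have : x k = (((x k).val : ℤ) : ZMod 3) := by simp
    rw [AddMonoidHom.comp_apply, Pi.evalAddMonoidHom_apply]
    conv_rhs => rw [this]
    rw [ZMod.lift_coe]
    simp
  have h2 := indep _ (cl_sum _ h1)
  funext k
  have h3 := (ZMod.intCast_zmod_eq_zero_iff_dvd _ 3).2 (h2 k)
  simpa using h3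

theorem finrank_MH : Module.finrank ℤ (MH ℤ 13 4) = 24596 := by
  have h1 := Submodule.finrank_quotient_add_finrank ((LinearMap.range (D 5)).comap (cycLow ℤ rk K 5).subtype)
  have h2 : Module.finrank ℤ ((LinearMap.range (D 5)).comap (cycLow ℤ rk K 5).subtype)
      = Module.finrank ℤ (LinearMap.range (D 5)) :=
    (Submodule.comapSubtypeEquivOfLe (range_le_cyc 5)).finrank_eq
  have h3 := rank_null' 5 6 rfl
  rw [card6, rank_cyc6] at h3
  rw [rank_cyc5, h2] at h1
  have h4 : Module.finrank ℤ (MH ℤ 13 4) + Module.finrank ℤ (LinearMap.range (D 5)) = 158807 := h1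
  generalize Module.finrank ℤ (MH ℤ 13 4) = u at h4 ⊢
  generalize Module.finrank ℤ (LinearMap.range (D 5)) = v at h4 h3
  clear h1 h2
  omega

theorem one3 : (3 : ℕ) • (fun _ => 1 : Fin 10 → ZMod 3) = 0 := by decide

theorem assembly (G : Type) [AddCommGroup G] [Module.Finite ℤ G] (N : ℕ) (hr : Module.finrank ℤ G = N)
    (g : (Fin 10 → ZMod 3) →+ G) (hg : Function.Injective g) :
    (∃ (T : Type) (_ : AddCommGroup T), Finite T ∧
        (∃ f : (Fin 10 → ZMod 3) →+ T, Function.Injective f) ∧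
        Nonempty (G ≃+ T × (Fin N → ℤ))) ∧
      ∃ x : G, addOrderOf x = 3 := by
  have : AddGroup.FG G := Module.Finite.iff_addGroup_fg.1 inferInstance
  obtain ⟨n, ι, fι, p, hp, e, ⟨φ⟩⟩ := AddCommGroup.equiv_free_prod_directSum_zmod G
  classical
  have : ∀ i, NeZero (p i ^ e i) := fun i => ⟨pow_ne_zero _ (hp i).ne_zero⟩
  let ψ : G ≃+ (Fin n → ℤ) × ((i : ι) → ZMod (p i ^ e i)) :=
    φ.trans (Finsupp.addEquivFunOnFinite.prodCongr (DirectSum.addEquivProd _))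
  have tor : ∀ y : (i : ι) → ZMod (p i ^ e i), ∃ m : ℤ, m ≠ 0 ∧ m • y = 0 := by
    intro y
    refine ⟨((addOrderOf y : ℕ) : ℤ), ?_, ?_⟩
    · exact_mod_cast (addOrderOf_pos y).ne'
    · rw [natCast_zsmul, addOrderOf_nsmul_eq_zero]
  have hn : n = N := by
    let q : G →ₗ[ℤ] (Fin n → ℤ) := ((AddMonoidHom.fst _ _).comp ψ.toAddMonoidHom).toIntLinearMap
    have hq : ∀ x, q x = (ψ x).1 := fun x => rfl
    have h1 := Submodule.finrank_quotient_add_finrank (LinearMap.ker q)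
    have hs : Function.Surjective q := fun v => ⟨ψ.symm (v, 0), by simp [hq]⟩
    rw [(q.quotKerEquivOfSurjective hs).finrank_eq, hr] at h1
    have h2 : Module.finrank ℤ (LinearMap.ker q) = 0 := by
      rw [Module.finrank_eq_zero_iff]
      rintro ⟨x, hx⟩
      obtain ⟨m, hm, hm2⟩ := tor (ψ x).2
      refine ⟨m, hm, ?_⟩
      ext
      apply ψ.injective
      rw [LinearMap.mem_ker, hq] at hx
      simp only [Submodule.coe_smul, map_zsmul, ZeroMemClass.coe_zero, map_zero]
      exact Prod.ext (by simp [hx]) (by simpa using hm2)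
    rw [h2] at h1
    simpa using h1
  subst hn
  refine ⟨⟨(i : ι) → ZMod (p i ^ e i), inferInstance, inferInstance,
    ⟨((AddMonoidHom.snd _ _).comp ψ.toAddMonoidHom).comp g, ?_⟩, ⟨ψ.trans AddEquiv.prodComm⟩⟩, ?_⟩
  · rw [injective_iff_map_eq_zero]
    intro x hx
    have hx2 : (ψ (g x)).2 = 0 := hx
    have h3 : (3 : ℤ) • x = 0 := by
      funext i
      have : (3 : ZMod 3) = 0 := by decide
      simp [this]
    have h4 : (3 : ℤ) • ψ (g x) = 0 := by rw [← map_zsmul, ← map_zsmul, h3, map_zero, map_zero]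
    have h5 : (ψ (g x)).1 = 0 := by
      funext i
      have := congrFun (congrArg Prod.fst h4) i
      simpa using this
    have h6 : ψ (g x) = 0 := Prod.ext h5 hx2
    have h7 : g x = 0 := ψ.injective (by rw [h6, map_zero])
    exact hg (by rw [h7, map_zero])
  · refine ⟨g (fun _ => 1), addOrderOf_eq_prime ?_ ?_⟩
    · rw [← map_nsmul]
      rw [one3, map_zero]
    · intro h
      have := hg (h.trans (map_zero g).symm)
      exact one_ne_zero (congrFun this 0)

end MM

open MatchPaper in
/-- `H̃₄(M₁₃; ℤ) ≅ T ⊕ ℤ^24596` with `T` a finite group containing a copy of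
`(ℤ/3)^10`; in particular `H̃₄(M₁₃; ℤ)` contains `3`-torsion. -/
theorem homology_M13_degree_four :
    (∃ (T : Type) (_ : AddCommGroup T), Finite T ∧
        (∃ f : (Fin 10 → ZMod 3) →+ T, Function.Injective f) ∧
        Nonempty (MH ℤ 13 4 ≃+ T × (Fin 24596 → ℤ))) ∧
      ∃ x : MH ℤ 13 4, addOrderOf x = 3 := by
  exact MM.assembly (MH ℤ 13 4) 24596 MM.finrank_MH MM.hh MM.hh_inj
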